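/- The relativized Lascar group Gal_L(Σ, e), the relativized KP group Gal_KP(Σ, e), and the relativized Shelah group Gal_S(Σ, e) do not depend on the choice of the monster model: for monster models 𝔠 ≺ 𝔠', the map sending the coset of f↾Σ(𝔠) to the coset of f'↾Σ(𝔠'), where f' ∈ Aut_e(𝔠') is any extension of f ∈ Aut_e(𝔠), is a well-defined group isomorphism Gal_X(Σ(𝔠), e) ≅ Gal_X(Σ(𝔠'), e) for each X ∈ {L, KP, S}. -/

import Mathlib

/- Framework: relativized Lascar groups of a first-order theory over a
hyperimaginary, following "Relativized Galois groups of first order theories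
over a hyperimaginary" by H. Lee and J. Lee. -/

open FirstOrder Cardinal Pointwise

universe u

namespace RelLascar

variable {L : FirstOrder.Language.{u, u}} {M : Type u} [L.Structure M]

/-- The group of automorphisms of the monster model `M`. -/
instance : Group (M ≃[L] M) where
  mul f g := f.comp g
  one := FirstOrder.Language.Equiv.refl L M
  inv f := f.symm
  mul_assoc f g h := (FirstOrder.Language.Equiv.comp_assoc h g f).symm
  one_mul := FirstOrder.Language.Equiv.refl_comp
  mul_one := FirstOrder.Language.Equiv.comp_refl
  inv_mul_cancel := FirstOrder.Language.Equiv.symm_comp_self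

/-- Automorphisms act on the monster model. -/
instance : MulAction (M ≃[L] M) M where
  smul f x := f x
  one_smul _ := rfl
  mul_smul _ _ _ := rfl

@[simp] theorem autSmul_def (f : M ≃[L] M) (x : M) : f • x = f x := rfl

/-- The solution set in `M` of a set of formulas in variables `ι` with
parameters `prm : π → M`. -/
def SolSet {ι π : Type u} (p : Set (L.Formula (ι ⊕ π))) (prm : π → M) : Set (ι → M) :=
  {v | ∀ φ ∈ p, φ.Realize (Sum.elim v prm)}

/-- A set of `ι`-tuples is type-definable over the parameters `prm`. -/
def TypeDefinableOver {ι π : Type u} (prm : π → M) (X : Set (ι → M)) : Prop :=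
  ∃ p : Set (L.Formula (ι ⊕ π)), X = SolSet p prm

/-- Two tuples have the same (complete) type over `∅`. -/
def SameTp {ι : Type u} (c d : ι → M) : Prop :=
  ∀ φ : L.Formula ι, φ.Realize c ↔ φ.Realize d

/-- `M` is a monster model with degree of saturation and strong homogeneity `κ`:
`κ` is uncountable, tuples of size `< κ` with the same type are conjugate under an
automorphism, and every partial type in `< κ` variables over `< κ` parameters that
is finitely realized in `M` is realized in `M`.  ("Small" means of size `< κ`.) -/
def IsMonster (κ : Cardinal.{u}) (L : FirstOrder.Language.{u, u}) (M : Type u) [L.Structure M] : Prop :=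
  ℵ₀ < κ ∧
  (∀ (ι : Type u) (c d : ι → M), #ι < κ → SameTp (L := L) (M := M) c d →
      ∃ f : M ≃[L] M, ∀ i, f (c i) = d i) ∧
  (∀ (ι π : Type u) (prm : π → M) (p : Set (L.Formula (ι ⊕ π))), #ι < κ → #π < κ →
      (∀ q : Finset (L.Formula (ι ⊕ π)), ↑q ⊆ p →
        ∃ v : ι → M, ∀ φ ∈ (q : Set (L.Formula (ι ⊕ π))), φ.Realize (Sum.elim v prm)) →
      ∃ v : ι → M, v ∈ SolSet p prm)

variable (κ : Cardinal.{u})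

section Hyperimaginary

/- The hyperimaginary `e = a_E`, where `E` is the `∅`-type-definable equivalence
relation defined by the set of formulas `pE` and `a : γ → M`. -/
variable {γ : Type u} (pE : Set (L.Formula (γ ⊕ γ))) (a : γ → M)

/-- The relation defined by a set of formulas in variables `δ ⊕ δ` (with no
parameters); for `pE` this is the equivalence relation `E`. -/
def Frel {δ : Type u} (pF : Set (L.Formula (δ ⊕ δ))) (x y : δ → M) : Prop :=
  ∀ φ ∈ pF, φ.Realize (Sum.elim x y)

/-- The class of a tuple `x` under the relation defined by `pF`; for an
equivalence relation this is the hyperimaginary `x_F` (as a set of representatives). -/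
def Fclass {δ : Type u} (pF : Set (L.Formula (δ ⊕ δ))) (x : δ → M) : Set (δ → M) :=
  {y | Frel pF x y}

/-- `Aut_e(𝔠)`: the subgroup of automorphisms fixing the hyperimaginary
`e = a_E` setwise. -/
def AutE : Subgroup (M ≃[L] M) := MulAction.stabilizer (M ≃[L] M) (Fclass pE a)

/-- `Aut_e(𝔠)` as a group. -/
abbrev Ge := ↥(AutE pE a)

/-- The hyperimaginary `e` is definable over the tuple `t` (i.e. `e ∈ dcl(t)`):
every automorphism fixing `t` pointwise fixes `e`. -/
def eInDclTuple {ι : Type u} (t : ι → M) : Prop :=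
  ∀ f : M ≃[L] M, (∀ i, f (t i) = t i) → f ∈ AutE pE a

/-- The set of elements of `Aut_e(𝔠)` fixing pointwise some small elementary
substructure (model) `N` with `e ∈ dcl(N)`. -/
def modelFixers : Set (Ge pE a) :=
  {f | ∃ N : L.ElementarySubstructure M, #N < κ ∧
        (∀ g : M ≃[L] M, (∀ x ∈ N, g x = x) → g ∈ AutE pE a) ∧
        ∀ x ∈ N, (f : M ≃[L] M) x = x}

/-- `Autf_L(𝔠, e)`: the normal subgroup of `Aut_e(𝔠)` generated by the
pointwise stabilizers of small models `N` with `e ∈ dcl(N)`. -/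
def AutfL : Subgroup (Ge pE a) := Subgroup.normalClosure (modelFixers κ pE a)

/-- `c ≡ᴸ_e d` : the tuples have the same Lascar strong type over `e`. -/
def LEq {ι : Type u} (c d : ι → M) : Prop := ∃ f ∈ AutfL κ pE a, f • c = d

theorem LEq.refl {ι : Type u} (c : ι → M) : LEq κ pE a c c :=
  ⟨1, one_mem _, one_smul _ _⟩

theorem LEq.symm {ι : Type u} {c d : ι → M} (h : LEq κ pE a c d) : LEq κ pE a d c := by
  obtain ⟨f, hf, rfl⟩ := h
  exact ⟨f⁻¹, inv_mem hf, inv_smul_smul f c⟩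

theorem LEq.trans {ι : Type u} {c d e : ι → M} (h1 : LEq κ pE a c d)
    (h2 : LEq κ pE a d e) : LEq κ pE a c e := by
  obtain ⟨f, hf, rfl⟩ := h1
  obtain ⟨g, hg, rfl⟩ := h2
  exact ⟨g * f, mul_mem hg hf, (mul_smul g f c).symm ▸ rfl⟩

end Hyperimaginary

section Sigma

variable {γ : Type u} (pE : Set (L.Formula (γ ⊕ γ))) (a : γ → M)
variable {V β : Type u} {pS : Set (L.Formula (V ⊕ β))} {bp : β → M}

/-- The solution set `Σ(𝔠)` of the partial type `Σ` (given by formulas `pS` over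
the parameters `bp`). -/
abbrev Sol (pS : Set (L.Formula (V ⊕ β))) (bp : β → M) : Set (V → M) := SolSet pS bp

/-- The type of realizations of `Σ`. -/
abbrev SolT (pS : Set (L.Formula (V ⊕ β))) (bp : β → M) := ↥(Sol pS bp)

variable (pS bp) in
/-- The partial type `Σ` is `e`-invariant. -/
def SolInv : Prop := ∀ (g : Ge pE a) (v : V → M), v ∈ Sol pS bp → g • v ∈ Sol pS bp

/-- The restriction homomorphism `Aut_e(𝔠) → Perm(Σ(𝔠))`, `f ↦ f ↾ Σ(𝔠)`. -/
def resPerm (hInv : SolInv pE a pS bp) : Ge pE a →* Equiv.Perm (SolT pS bp) where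
  toFun g :=
    { toFun := fun v => ⟨g • (v : V → M), hInv g v v.2⟩
      invFun := fun v => ⟨g⁻¹ • (v : V → M), hInv g⁻¹ v v.2⟩
      left_inv := fun v => Subtype.ext (inv_smul_smul g (v : V → M))
      right_inv := fun v => Subtype.ext (smul_inv_smul g (v : V → M)) }
  map_one' := Equiv.ext fun v => Subtype.ext (one_smul (Ge pE a) (v : V → M))
  map_mul' g h := Equiv.ext fun v => Subtype.ext (mul_smul g h (v : V → M))

/-- `Aut_e(Σ) = {f ↾ Σ(𝔠) : f ∈ Aut_e(𝔠)}`, as a subgroup of the permutations of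
`Σ(𝔠)`. -/
def AutES (hInv : SolInv pE a pS bp) : Subgroup (Equiv.Perm (SolT pS bp)) :=
  (resPerm pE a hInv).range

/-- `Aut_e(Σ)` as a group. -/
abbrev GS (hInv : SolInv pE a pS bp) := ↥(AutES pE a hInv)

/-- The restriction map `ξ : Aut_e(𝔠) → Aut_e(Σ)`. -/
def toGS (hInv : SolInv pE a pS bp) : Ge pE a →* GS pE a hInv :=
  (resPerm pE a hInv).rangeRestrict

/-- A tuple of realizations of `Σ`, flattened to a tuple of elements of `M`. -/
def flat {ι : Type u} (c : ι → SolT pS bp) : ι × V → M := fun p => (c p.1 : V → M) p.2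

theorem flat_toGS_smul (hInv : SolInv pE a pS bp) {ι : Type u} (g : Ge pE a)
    (c : ι → SolT pS bp) : flat ((toGS pE a hInv g) • c) = g • flat c := rfl

theorem flat_smul_of_res (hInv : SolInv pE a pS bp) {ι : Type u} {τ : GS pE a hInv}
    {g : Ge pE a} (hg : resPerm pE a hInv g = ↑τ) (c : ι → SolT pS bp) :
    flat (τ • c) = g • flat c := by
  have : τ = toGS pE a hInv g := Subtype.ext hg.symm
  subst this
  rfl

/-- `Autf_L(Σ, e)`: the subgroup of `Aut_e(Σ)` consisting of those restricted
automorphisms `σ` such that every small tuple of realizations of `Σ` has the same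
Lascar strong type over `e` as its image under `σ`. -/
def AutfLS (hInv : SolInv pE a pS bp) : Subgroup (GS pE a hInv) where
  carrier := {σ | ∀ (ι : Type u), #ι < κ → ∀ c : ι → SolT pS bp,
      LEq κ pE a (flat c) (flat (σ • c))}
  one_mem' := by
    intro ι _ c
    rw [one_smul]
    exact LEq.refl κ pE a _
  mul_mem' := by
    intro σ τ hσ hτ ι hι c
    rw [mul_smul]
    exact LEq.trans κ pE a (hτ ι hι c) (hσ ι hι (τ • c))
  inv_mem' := by
    intro σ hσ ι hι c
    have h := hσ ι hι (σ⁻¹ • c)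
    rw [smul_inv_smul] at h
    exact LEq.symm κ pE a h

theorem AutfLS_normal (hInv : SolInv pE a pS bp) : (AutfLS κ pE a hInv).Normal := by
  constructor
  intro σ hσ τ ι hι c
  obtain ⟨g, hg⟩ := τ.2
  have hginv : resPerm pE a hInv g⁻¹ = ↑τ⁻¹ := by
    rw [map_inv, hg]
    rfl
  obtain ⟨f, hf, hfe⟩ := hσ ι hι (τ⁻¹ • c)
  refine ⟨g * f * g⁻¹, (Subgroup.normalClosure_normal).conj_mem f hf g, ?_⟩
  have h1 : flat (τ⁻¹ • c) = g⁻¹ • flat c := flat_smul_of_res pE a hInv hginv c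
  have h2 : flat ((τ * σ * τ⁻¹) • c) = g • flat (σ • τ⁻¹ • c) := by
    rw [mul_smul, mul_smul]
    exact flat_smul_of_res pE a hInv hg _
  rw [h2, ← hfe, h1, ← mul_smul, ← mul_smul]

/-- The relativized Lascar group `Gal_L(Σ, e) = Aut_e(Σ) / Autf_L(Σ, e)`. -/
def GalL (hInv : SolInv pE a pS bp) := GS pE a hInv ⧸ AutfLS κ pE a hInv

/-- The projection `π_b : Aut_e(Σ) → Gal_L(Σ, e)`. -/
def projb (hInv : SolInv pE a pS bp) : GS pE a hInv → GalL κ pE a hInv :=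
  QuotientGroup.mk

/-- The projection `π_Σ : Aut_e(𝔠) → Gal_L(Σ, e)`. -/
def projS (hInv : SolInv pE a pS bp) : Ge pE a → GalL κ pE a hInv :=
  fun g => projb κ pE a hInv (toGS pE a hInv g)

/-- A Lascar tuple in `Σ` over `e`: a small tuple `b` of realizations of `Σ` such
that `Autf_L(Σ, e) = {σ ∈ Aut_e(Σ) : b ≡ᴸ_e σ(b)}`. -/
def IsLascarTuple (hInv : SolInv pE a pS bp) {ιb : Type u} (b : ιb → SolT pS bp) : Prop :=
  #ιb < κ ∧ ∀ σ : GS pE a hInv,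
    σ ∈ AutfLS κ pE a hInv ↔ LEq κ pE a (flat b) (flat (σ • b))

variable (pS bp) in
/-- `e ∈ dcl(Σ)`: there is a small tuple of realizations of `Σ` over which `e` is
definable. -/
def eInDclSigma : Prop :=
  ∃ (ι : Type u) (c : ι → SolT pS bp), #ι < κ ∧ eInDclTuple pE a (flat c)

/-- The complete type of the tuple `v` over the parameters `prm` (with both
indexed by `ι`): the set of formulas realized by `v` with parameters `prm`. -/
def tpOver {ι : Type u} (prm v : ι → M) : Set (L.Formula (ι ⊕ ι)) :=
  {φ | φ.Realize (Sum.elim v prm)}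

/-- The type space `S_b(b) = {tp(f(b)/b) : f ∈ Aut_e(𝔠)}` over a tuple `b` of
realizations of `Σ`. -/
def Sb {ιb : Type u} (b : ιb → SolT pS bp) :
    Set (Set (L.Formula ((ιb × V) ⊕ (ιb × V)))) :=
  Set.range fun g : Ge pE a => tpOver (flat b) (g • flat b)

/-- The logic topology on a set of types: the subspace topology induced from the
product topology on `Formula → Bool` via characteristic functions. -/
noncomputable def typeSetTop {F : Type u} (X : Set (Set F)) : TopologicalSpace ↥X :=
  TopologicalSpace.induced
    (fun p (φ : F) => (p : Set F).boolIndicator φ) inferInstance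

/-- The map `ν_b : S_b(b) → Gal_L(Σ, e)`, `tp(σ(b)/b) ↦ [σ]`. -/
noncomputable def nub (hInv : SolInv pE a pS bp) {ιb : Type u} (b : ιb → SolT pS bp) :
    ↥(Sb pE a b) → GalL κ pE a hInv :=
  fun p => projS κ pE a hInv (Set.mem_range.mp p.2).choose

/-- The topology `𝔱_b` on the relativized Lascar group `Gal_L(Σ, e)`: the quotient
topology induced by `ν_b` from the logic topology on `S_b(b)`. -/
noncomputable def galTopb (hInv : SolInv pE a pS bp) {ιb : Type u}
    (b : ιb → SolT pS bp) : TopologicalSpace (GalL κ pE a hInv) :=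
  (typeSetTop (Sb pE a b)).coinduced (nub κ pE a hInv b)

end Sigma

section GalT

variable {γ : Type u} (pE : Set (L.Formula (γ ⊕ γ))) (a : γ → M)

/-- The Lascar group `Gal_L(T, e) = Aut_e(𝔠) / Autf_L(𝔠, e)`. -/
def GalT := Ge pE a ⧸ AutfL κ pE a

/-- The projection `π : Aut_e(𝔠) → Gal_L(T, e)`. -/
def projT : Ge pE a → GalT κ pE a := QuotientGroup.mk

/-- The type space `S_N(N) = {tp(f(N)/N) : f ∈ Aut_e(𝔠)}` over a small model `N`. -/
def SMod (N : L.ElementarySubstructure M) : Set (Set (L.Formula (↥N ⊕ ↥N))) :=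
  Set.range fun g : Ge pE a =>
    tpOver (Subtype.val : ↥N → M) (g • (Subtype.val : ↥N → M))

/-- The map `ν : S_N(N) → Gal_L(T, e)`, `tp(f(N)/N) ↦ [f]`. -/
noncomputable def nuT (N : L.ElementarySubstructure M) :
    ↥(SMod pE a N) → GalT κ pE a :=
  fun p => projT κ pE a (Set.mem_range.mp p.2).choose

/-- The standard quotient topology on the Lascar group `Gal_L(T, e)` induced via
the type space over a small model `N` (with `e ∈ dcl(N)`). -/
noncomputable def galTopT (N : L.ElementarySubstructure M) :
    TopologicalSpace (GalT κ pE a) :=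
  (typeSetTop (SMod pE a N)).coinduced (nuT κ pE a N)

/-- `Autf_KP(𝔠, e)`: the preimage under `π` of the closure of the identity in
`Gal_L(T, e)`. -/
noncomputable def AutfKPset (N : L.ElementarySubstructure M) : Set (Ge pE a) :=
  projT κ pE a ⁻¹' (@closure _ (galTopT κ pE a N) {projT κ pE a 1})

/-- `Autf_S(𝔠, e)`: the preimage under `π` of the connected component of the
identity in `Gal_L(T, e)`. -/
noncomputable def AutfSset (N : L.ElementarySubstructure M) : Set (Ge pE a) :=
  projT κ pE a ⁻¹' (@connectedComponent _ (galTopT κ pE a N) (projT κ pE a 1))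

/-- `c ≡ᴷᴾ_e d` : the tuples have the same KP strong type over `e`. -/
def KPeq (N : L.ElementarySubstructure M) {ι : Type u} (c d : ι → M) : Prop :=
  ∃ f ∈ AutfKPset κ pE a N, f • c = d

/-- `c ≡ˢ_e d` : the tuples have the same Shelah strong type over `e`. -/
def Seq (N : L.ElementarySubstructure M) {ι : Type u} (c d : ι → M) : Prop :=
  ∃ f ∈ AutfSset κ pE a N, f • c = d

end GalT

section Relativized

variable {γ : Type u} (pE : Set (L.Formula (γ ⊕ γ))) (a : γ → M)
variable {V β : Type u} {pS : Set (L.Formula (V ⊕ β))} {bp : β → M}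

/-- `Autf_KP(Σ, e)`: the set of restricted automorphisms fixing the KP strong
type of every small tuple of realizations of `Σ`. -/
noncomputable def AutfKPSset (hInv : SolInv pE a pS bp) (N : L.ElementarySubstructure M) :
    Set (GS pE a hInv) :=
  {σ | ∀ (ι : Type u), #ι < κ → ∀ c : ι → SolT pS bp,
      KPeq κ pE a N (flat c) (flat (σ • c))}

/-- `Autf_S(Σ, e)`: the set of restricted automorphisms fixing the Shelah strong
type of every small tuple of realizations of `Σ`. -/
noncomputable def AutfSSset (hInv : SolInv pE a pS bp) (N : L.ElementarySubstructure M) :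
    Set (GS pE a hInv) :=
  {σ | ∀ (ι : Type u), #ι < κ → ∀ c : ι → SolT pS bp,
      Seq κ pE a N (flat c) (flat (σ • c))}

/-- The orbit under `Aut_e(𝔠)` of the hyperimaginary given by the class of `x`
under the relation defined by `pF` is small ("`x_F` is bounded over `e`"). -/
def BoundedClass {δ : Type u} (pF : Set (L.Formula (δ ⊕ δ))) (x : δ → M) : Prop :=
  #↥(Set.range fun g : Ge pE a => g • Fclass pF x) < κ

/-- The orbit under `Aut_e(𝔠)` of the hyperimaginary given by the class of `x` is
finite ("`x_F` is algebraic over `e`"). -/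
def FiniteClass {δ : Type u} (pF : Set (L.Formula (δ ⊕ δ))) (x : δ → M) : Prop :=
  (Set.range fun g : Ge pE a => g • Fclass pF x).Finite

/-- `f` fixes the hyperimaginary given by the class of `x` (setwise). -/
def FixesClass (f : Ge pE a) {δ : Type u} (pF : Set (L.Formula (δ ⊕ δ)))
    (x : δ → M) : Prop :=
  f • Fclass pF x = Fclass pF x

variable (pS bp) in
/-- `f` fixes every hyperimaginary that is bounded over `e` and has a
representative which is a small tuple of realizations of `Σ`, i.e. `f` fixes
`bdd(e) ∩ Σ` pointwise. -/
def fixesAllBddS (f : Ge pE a) : Prop :=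
  ∀ (ι : Type u) (pF : Set (L.Formula ((ι × V) ⊕ (ι × V)))) (c : ι → SolT pS bp),
    #ι < κ → Equivalence (Frel (M := M) pF) → BoundedClass κ pE a pF (flat c) →
    FixesClass pE a f pF (flat c)

variable (pS bp) in
/-- `f` fixes every hyperimaginary that is algebraic over `e` and has a
representative which is a small tuple of realizations of `Σ`, i.e. `f` fixes
`acl(e) ∩ Σ` pointwise. -/
def fixesAllAclS (f : Ge pE a) : Prop :=
  ∀ (ι : Type u) (pF : Set (L.Formula ((ι × V) ⊕ (ι × V)))) (c : ι → SolT pS bp),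
    #ι < κ → Equivalence (Frel (M := M) pF) → FiniteClass pE a pF (flat c) →
    FixesClass pE a f pF (flat c)

end Relativized


section More

variable {γ : Type u} (pE : Set (L.Formula (γ ⊕ γ))) (a : γ → M)
variable {V β : Type u} {pS : Set (L.Formula (V ⊕ β))} {bp : β → M}

theorem mem_AutfLS_iff (hInv : SolInv pE a pS bp) {σ : GS pE a hInv} :
    σ ∈ AutfLS κ pE a hInv ↔ ∀ (ι : Type u), #ι < κ → ∀ c : ι → SolT pS bp,
      LEq κ pE a (flat c) (flat (σ • c)) := Iff.rfl

theorem toGS_mem_autfLS (hInv : SolInv pE a pS bp) {f : Ge pE a}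
    (hf : f ∈ AutfL κ pE a) : toGS pE a hInv f ∈ AutfLS κ pE a hInv :=
  (mem_AutfLS_iff κ pE a hInv).mpr
    (fun ι _ c => ⟨f, hf, (flat_toGS_smul pE a hInv f c).symm⟩)

instance AutfL_normal : (AutfL κ pE a).Normal :=
  Subgroup.normalClosure_normal

/-- The group structure of the relativized Lascar group `Gal_L(Σ, e)`. -/
noncomputable def galLGroup (hInv : SolInv pE a pS bp) : Group (GalL κ pE a hInv) :=
  @QuotientGroup.Quotient.group _ _ (AutfLS κ pE a hInv) (AutfLS_normal κ pE a hInv)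

/-- The natural projection `ξ_L : Gal_L(T, e) → Gal_L(Σ, e)`. -/
noncomputable def xiL (hInv : SolInv pE a pS bp) : GalT κ pE a → GalL κ pE a hInv :=
  haveI := AutfLS_normal κ pE a hInv
  ⇑(QuotientGroup.map (AutfL κ pE a) (AutfLS κ pE a hInv) (toGS pE a hInv)
    (fun _ hf => Subgroup.mem_comap.mpr (toGS_mem_autfLS κ pE a hInv hf)))

/-- The orbit equivalence relation `≡ᴴ` of a set `H` of restricted automorphisms,
on tuples of realizations of `Σ`. -/
def orbEq {hInv : SolInv pE a pS bp} (H : Set (GS pE a hInv)) {ι : Type u}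
    (c d : ι → SolT pS bp) : Prop :=
  ∃ h ∈ H, h • c = d

end More


section MonsterChange

open Filter

variable {κ}

section Types

variable (L) in
/-- The tuple `w` realizes the limit along `𝒰` of the types of the tuples `v α`. -/
def IsTypeLim {A X : Type u} (𝒰 : Ultrafilter A) (v : A → X → M) (w : X → M) : Prop :=
  ∀ φ : L.Formula X, φ.Realize w ↔ ∀ᶠ α in 𝒰, φ.Realize (v α)

theorem IsTypeLim.reindex {A X Y : Type u} {𝒰 : Ultrafilter A} {v : A → X → M} {w : X → M}
    (h : IsTypeLim L 𝒰 v w) (r : Y → X) {v' : A → Y → M} {w' : Y → M}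
    (hv : ∀ α y, v' α y = v α (r y)) (hw : ∀ y, w' y = w (r y)) : IsTypeLim L 𝒰 v' w' := by
  obtain rfl : v' = fun α => v α ∘ r := funext fun α => funext (hv α)
  obtain rfl : w' = w ∘ r := funext hw
  intro φ
  simpa only [Language.Formula.realize_relabel] using h (φ.relabel r)

theorem IsTypeLim.congr {A X : Type u} {𝒰 : Ultrafilter A} {v v' : A → X → M} {w : X → M}
    (h : IsTypeLim L 𝒰 v w) (hv : ∀ᶠ α in 𝒰, SameTp (L := L) (v α) (v' α)) :
    IsTypeLim L 𝒰 v' w := by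
  intro φ
  rw [h φ]
  exact eventually_congr (hv.mono fun α hα => hα φ)

theorem IsTypeLim.sameTp {A X : Type u} {𝒰 : Ultrafilter A} {v : A → X → M} {w w' : X → M}
    (h : IsTypeLim L 𝒰 v w) (h' : IsTypeLim L 𝒰 v w') : SameTp (L := L) w w' :=
  fun φ => (h φ).trans (h' φ).symm

theorem IsTypeLim.sameTp_of_const {A X : Type u} {𝒰 : Ultrafilter A} {v : A → X → M}
    {w d : X → M} (h : IsTypeLim L 𝒰 v w) (hd : ∀ᶠ α in 𝒰, SameTp (L := L) (v α) d) :
    SameTp (L := L) w d := by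
  intro φ
  rw [h φ, eventually_congr (hd.mono fun α hα => hα φ)]
  exact eventually_const

theorem IsTypeLim.eq {A X : Type u} {𝒰 : Ultrafilter A} {v : A → X → M} {w : X → M}
    (h : IsTypeLim L 𝒰 v w) {i j : X} (hij : ∀ᶠ α in 𝒰, v α i = v α j) : w i = w j := by
  have := h ((Language.Term.var i).equal (Language.Term.var j))
  simp only [Language.Formula.realize_equal, Language.Term.realize_var] at this
  exact this.2 hij

theorem SameTp.refl {X : Type u} (c : X → M) : SameTp (L := L) c c := fun _ => Iff.rfl

theorem SameTp.symm {X : Type u} {c d : X → M} (h : SameTp (L := L) c d) :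
    SameTp (L := L) d c := fun φ => (h φ).symm

theorem SameTp.trans {X : Type u} {c d e : X → M} (h : SameTp (L := L) c d)
    (h' : SameTp (L := L) d e) : SameTp (L := L) c e := fun φ => (h φ).trans (h' φ)

theorem SameTp.reindex {X Y : Type u} {c d : X → M} (h : SameTp (L := L) c d) (r : Y → X)
    {c' d' : Y → M} (hc : ∀ y, c' y = c (r y)) (hd : ∀ y, d' y = d (r y)) :
    SameTp (L := L) c' d' := by
  obtain rfl : c' = c ∘ r := funext hc
  obtain rfl : d' = d ∘ r := funext hd
  intro φ
  simpa only [Language.Formula.realize_relabel] using h (φ.relabel r)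

theorem SameTp.eq_iff {X : Type u} {c d : X → M} (h : SameTp (L := L) c d) (i j : X) :
    c i = c j ↔ d i = d j := by
  have := h ((Language.Term.var i).equal (Language.Term.var j))
  simpa only [Language.Formula.realize_equal, Language.Term.realize_var] using this

theorem sameTp_smul {X : Type u} (f : M ≃[L] M) (c : X → M) : SameTp (L := L) (f • c) c :=
  fun φ => Language.StrongHomClass.realize_formula f φ

theorem sameTp_of_smul {X : Type u} (f : M ≃[L] M) {c d : X → M} (h : ∀ x, d x = f (c x)) :
    SameTp (L := L) c d := by
  obtain rfl : d = f • c := funext h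
  exact (sameTp_smul f c).symm

theorem SameTp.of_emb {M' : Type u} [L.Structure M'] (emb : M ↪ₑ[L] M') {X : Type u}
    {c d : X → M} (h : SameTp (L := L) (⇑emb ∘ c) (⇑emb ∘ d)) : SameTp (L := L) c d := by
  intro φ
  simpa only [emb.map_formula] using h φ

theorem SameTp.map_emb {M' : Type u} [L.Structure M'] (emb : M ↪ₑ[L] M') {X : Type u}
    {c d : X → M} (h : SameTp (L := L) c d) : SameTp (L := L) (⇑emb ∘ c) (⇑emb ∘ d) := by
  intro φ
  simpa only [emb.map_formula] using h φ

theorem IsMonster.exists_smul_eq (hM : IsMonster κ L M) {X : Type u} (hX : #X < κ)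
    {c d : X → M} (h : SameTp (L := L) c d) : ∃ f : M ≃[L] M, f • c = d := by
  obtain ⟨f, hf⟩ := hM.2.1 X c d hX h
  exact ⟨f, funext hf⟩

theorem IsMonster.exists_realize_of_complete (hM : IsMonster κ L M) {ι π : Type u} (hι : #ι < κ)
    (hπ : #π < κ) (prm : π → M) (P : L.Formula (ι ⊕ π) → Prop) (htop : P ⊤)
    (hinf : ∀ φ ψ, P φ → P ψ → P (φ ⊓ ψ)) (hnot : ∀ φ, P φ ∨ P φ.not)
    (hsat : ∀ φ, P φ → ∃ v : ι → M, φ.Realize (Sum.elim v prm)) :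
    ∃ v : ι → M, ∀ φ, φ.Realize (Sum.elim v prm) ↔ P φ := by
  have hfin : ∀ q : Finset (L.Formula (ι ⊕ π)), (∀ φ ∈ q, P φ) →
      ∃ ψ, P ψ ∧ ∀ x : ι ⊕ π → M, ψ.Realize x → ∀ φ ∈ q, φ.Realize x := by
    classical
    intro q
    induction q using Finset.induction_on with
    | empty => exact fun _ => ⟨⊤, htop, by simp⟩
    | insert φ q _ ih =>
      intro h
      obtain ⟨ψ, hψ, hψq⟩ := ih fun χ hχ => h χ (Finset.mem_insert_of_mem hχ)
      refine ⟨φ ⊓ ψ, hinf _ _ (h φ (Finset.mem_insert_self _ _)) hψ, fun x hx χ hχ => ?_⟩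
      rw [Language.Formula.realize_inf] at hx
      rcases Finset.mem_insert.1 hχ with rfl | hχ
      · exact hx.1
      · exact hψq x hx.2 χ hχ
  obtain ⟨v, hv⟩ := hM.2.2 ι π prm {φ | P φ} hι hπ fun q hq => by
    obtain ⟨ψ, hψ, hψq⟩ := hfin q hq
    obtain ⟨v, hv⟩ := hsat ψ hψ
    exact ⟨v, hψq _ hv⟩
  refine ⟨v, fun φ => ⟨fun h => ?_, hv φ⟩⟩
  rcases hnot φ with h' | h'
  · exact h'
  · exact absurd h (Language.Formula.realize_not.1 (hv _ h'))

theorem IsMonster.exists_isTypeLim (hM : IsMonster κ L M) {ι π A : Type u} (hι : #ι < κ)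
    (hπ : #π < κ) (𝒰 : Ultrafilter A) (v : A → ι → M) (prm : π → M) :
    ∃ w : ι → M, IsTypeLim L 𝒰 (fun α => Sum.elim (v α) prm) (Sum.elim w prm) := by
  refine hM.exists_realize_of_complete hι hπ prm
    (fun φ => ∀ᶠ α in 𝒰, φ.Realize (Sum.elim (v α) prm)) ?_ ?_ ?_ ?_
  · exact Eventually.of_forall fun α => by simp
  · intro φ ψ hφ hψ
    filter_upwards [hφ, hψ] with α h1 h2
    exact Language.Formula.realize_inf.2 ⟨h1, h2⟩
  · intro φ
    simp only [Language.Formula.realize_not, Ultrafilter.eventually_not]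
    exact em _
  · intro φ hφ
    obtain ⟨α, hα⟩ := hφ.exists
    exact ⟨v α, hα⟩

theorem exists_realize_of_elementary {M' : Type u} [L.Structure M'] (emb : M ↪ₑ[L] M')
    {ι π : Type u} (v : ι → M') (prm : π → M) (φ : L.Formula (ι ⊕ π))
    (h : φ.Realize (Sum.elim v (⇑emb ∘ prm))) : ∃ w : ι → M, φ.Realize (Sum.elim w prm) := by
  classical
  rcases isEmpty_or_nonempty ι with hι | hι
  · refine ⟨isEmptyElim, ?_⟩
    rw [← emb.map_formula]
    convert h using 1
    ext (i | i)
    · exact isEmptyElim i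
    · rfl
  have : Nonempty M' := hι.map v
  have : Nonempty M := emb.elementarilyEquivalent.nonempty_iff.2 this
  let f : φ.freeVarFinset → π ⊕ {i : ι // Sum.inl i ∈ φ.freeVarFinset} := fun x =>
    match x with
    | ⟨Sum.inl i, hi⟩ => Sum.inr ⟨i, hi⟩
    | ⟨Sum.inr p, _⟩ => Sum.inl p
  have hfin : Finite {i : ι // Sum.inl i ∈ φ.freeVarFinset} :=
    Finite.of_injective (fun x => (⟨Sum.inl x.1, x.2⟩ : φ.freeVarFinset)) fun x y hxy => by
      simpa [Subtype.ext_iff] using hxy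
  let ψ : L.Formula (π ⊕ {i : ι // Sum.inl i ∈ φ.freeVarFinset}) :=
    Language.BoundedFormula.restrictFreeVar φ f
  have h1 : (ψ.iExs {i : ι // Sum.inl i ∈ φ.freeVarFinset}).Realize (⇑emb ∘ prm) := by
    rw [Language.Formula.realize_iExs]
    refine ⟨fun i => v i, ?_⟩
    refine (Language.BoundedFormula.realize_restrictFreeVar (Sum.elim v (⇑emb ∘ prm)) ?_).2 h
    rintro ⟨i | i, hi⟩ <;> rfl
  rw [emb.map_formula, Language.Formula.realize_iExs] at h1
  obtain ⟨w, hw⟩ := h1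
  let w' : ι → M := fun i => if hi : Sum.inl i ∈ φ.freeVarFinset then w ⟨i, hi⟩
    else Classical.arbitrary M
  refine ⟨w', (Language.BoundedFormula.realize_restrictFreeVar (Sum.elim w' prm) ?_).1 hw⟩
  rintro ⟨i | i, hi⟩
  · simp [f, w', hi]
  · rfl

theorem IsMonster.exists_sameTp_emb (hM : IsMonster κ L M) {M' : Type u} [L.Structure M']
    (emb : M ↪ₑ[L] M') {ι π : Type u} (hι : #ι < κ) (hπ : #π < κ) (v : ι → M') (prm : π → M) :
    ∃ w : ι → M,
      SameTp (L := L) (⇑emb ∘ Sum.elim w prm) (Sum.elim v (⇑emb ∘ prm)) := by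
  obtain ⟨w, hw⟩ := hM.exists_realize_of_complete hι hπ prm
    (fun φ => φ.Realize (Sum.elim v (⇑emb ∘ prm))) (by simp)
    (fun φ ψ h1 h2 => Language.Formula.realize_inf.2 ⟨h1, h2⟩)
    (fun φ => by
      rw [Language.Formula.realize_not]
      exact em _)
    (fun φ hφ => exists_realize_of_elementary emb v prm φ hφ)
  refine ⟨w, fun φ => ?_⟩
  rw [emb.map_formula, hw φ]

end Types

section Hyperimaginary

variable {γ : Type u} {pE : Set (L.Formula (γ ⊕ γ))} {a : γ → M}

theorem SameTp.frel_iff {X : Type u} {c d : X → M} (h : SameTp (L := L) c d) (r s : γ → X)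
    {x y x' y' : γ → M} (hx : ∀ i, x i = c (r i)) (hy : ∀ i, y i = c (s i))
    (hx' : ∀ i, x' i = d (r i)) (hy' : ∀ i, y' i = d (s i)) :
    Frel pE x y ↔ Frel pE x' y' := by
  have := h.reindex (c' := Sum.elim x y) (d' := Sum.elim x' y') (Sum.elim r s)
    (by rintro (i | i) <;> simp [hx, hy]) (by rintro (i | i) <;> simp [hx', hy'])
  exact forall₂_congr fun φ _ => this φ

theorem frel_smul (f : M ≃[L] M) (x y : γ → M) :
    Frel pE (f • x) (f • y) ↔ Frel pE x y :=
  (sameTp_smul f (Sum.elim x y)).frel_iff Sum.inl Sum.inr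
    (fun _ => rfl) (fun _ => rfl) (fun _ => rfl) (fun _ => rfl)

theorem frel_emb {M' : Type u} [L.Structure M'] (emb : M ↪ₑ[L] M') (x y : γ → M) :
    Frel pE (⇑emb ∘ x) (⇑emb ∘ y) ↔ Frel pE x y := by
  refine forall₂_congr fun φ _ => ?_
  rw [← Sum.comp_elim, emb.map_formula]

theorem mem_AutE_iff (hE : Equivalence (Frel (M := M) pE)) (f : M ≃[L] M) :
    f ∈ AutE pE a ↔ Frel pE a (f • a) := by
  have hcl : f • Fclass pE a = Fclass pE (f • a) := by
    ext y
    rw [Set.mem_smul_set_iff_inv_smul_mem]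
    change Frel pE a (f⁻¹ • y) ↔ Frel pE (f • a) y
    rw [← frel_smul f, smul_inv_smul]
  rw [AutE, MulAction.mem_stabilizer_iff, hcl]
  constructor
  · intro h
    have : f • a ∈ Fclass pE (f • a) := hE.refl _
    rw [h] at this
    exact this
  · intro h
    ext y
    exact ⟨fun hy => hE.trans h hy, fun hy => hE.trans (hE.symm h) hy⟩

theorem frel_smul_Ge (hE : Equivalence (Frel (M := M) pE)) (f : Ge pE a) :
    Frel pE a (f • a) := (mem_AutE_iff hE (f : M ≃[L] M)).1 f.2

theorem exists_Ge_smul_eq (hM : IsMonster κ L M) (hE : Equivalence (Frel (M := M) pE))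
    (hγ : #γ < κ) {ι : Type u} (hι : #ι < κ) {b w : ι → M} {w₀ : γ → M}
    (h : SameTp (L := L) (Sum.elim b a) (Sum.elim w w₀)) (hw : Frel pE a w₀) :
    ∃ g : Ge pE a, g • b = w := by
  obtain ⟨f, hf⟩ := hM.exists_smul_eq
    (by simpa using add_lt_of_lt hM.1.le hι hγ) h
  have h1 : f • b = w := funext fun i => congrFun hf (Sum.inl i)
  have h2 : f • a = w₀ := funext fun i => congrFun hf (Sum.inr i)
  exact ⟨⟨f, (mem_AutE_iff hE f).2 (h2 ▸ hw)⟩, h1⟩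

theorem exists_Ge_isTypeLim (hM : IsMonster κ L M) (hE : Equivalence (Frel (M := M) pE))
    (hγ : #γ < κ) {J ι π A : Type u} (hJ : #J < κ) (hι : #ι < κ) (hπ : #π < κ)
    (𝒰 : Ultrafilter A) (f : A → J → Ge pE a) (b : ι → M) (prm : π → M) :
    ∃ g : J → Ge pE a,
      IsTypeLim L 𝒰 (fun α => Sum.elim (fun p : J × ι => f α p.1 • b p.2) prm)
        (Sum.elim (fun p : J × ι => g p.1 • b p.2) prm) := by
  have hιγ : #(ι ⊕ γ) < κ := by simpa using add_lt_of_lt hM.1.le hι hγ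
  obtain ⟨w, hw⟩ := hM.exists_isTypeLim (ι := J × (ι ⊕ γ)) (π := π ⊕ γ)
    (by simpa using mul_lt_of_lt hM.1.le hJ hιγ) (by simpa using add_lt_of_lt hM.1.le hπ hγ) 𝒰
    (fun α p => f α p.1 • Sum.elim b a p.2) (Sum.elim prm a)
  have hg : ∀ j : J, ∃ g : Ge pE a, g • b = fun i => w (j, Sum.inl i) := by
    intro j
    have h1 : IsTypeLim L 𝒰 (fun α => f α j • Sum.elim b a)
        (Sum.elim (fun i => w (j, Sum.inl i)) fun i => w (j, Sum.inr i)) :=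
      hw.reindex (fun x => Sum.inl (j, x)) (fun _ _ => rfl) (by rintro (i | i) <;> rfl)
    refine exists_Ge_smul_eq hM hE hγ hι (w₀ := fun i => w (j, Sum.inr i))
      (h1.sameTp_of_const (Eventually.of_forall fun α => ?_)).symm fun φ hφ => ?_
    · exact sameTp_smul (f α j : M ≃[L] M) _
    · have h2 : IsTypeLim L 𝒰 (fun α => Sum.elim a (f α j • a))
          (Sum.elim a fun i => w (j, Sum.inr i)) :=
        hw.reindex (Sum.elim (fun i => Sum.inr (Sum.inr i)) fun i => Sum.inl (j, Sum.inr i))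
          (by rintro α (i | i) <;> rfl) (by rintro (i | i) <;> rfl)
      exact (h2 φ).2 (Eventually.of_forall fun α => frel_smul_Ge hE (f α j) φ hφ)
  choose g hg using hg
  refine ⟨g, hw.reindex (Sum.map (fun p => (p.1, Sum.inl p.2)) Sum.inl) ?_ ?_⟩
  · rintro α (p | p) <;> rfl
  · rintro (p | p)
    · exact congrFun (hg p.1) p.2
    · rfl

theorem exists_Ge_sameTp_emb (hM : IsMonster κ L M) (hE : Equivalence (Frel (M := M) pE))
    (hγ : #γ < κ) {M' : Type u} [L.Structure M'] (emb : M ↪ₑ[L] M')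
    (hE' : Equivalence (Frel (M := M') pE)) {J ι π : Type u} (hJ : #J < κ) (hι : #ι < κ)
    (hπ : #π < κ) (f : J → Ge pE (⇑emb ∘ a)) (b : ι → M) (prm : π → M) :
    ∃ g : J → Ge pE a,
      SameTp (L := L) (⇑emb ∘ Sum.elim (fun p : J × ι => g p.1 • b p.2) prm)
        (Sum.elim (fun p : J × ι => f p.1 • emb (b p.2)) (⇑emb ∘ prm)) := by
  have hιγ : #(ι ⊕ γ) < κ := by simpa using add_lt_of_lt hM.1.le hι hγ
  obtain ⟨w, hw⟩ := hM.exists_sameTp_emb emb (ι := J × (ι ⊕ γ)) (π := π ⊕ γ)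
    (by simpa using mul_lt_of_lt hM.1.le hJ hιγ) (by simpa using add_lt_of_lt hM.1.le hπ hγ)
    (fun p => f p.1 • emb (Sum.elim b a p.2)) (Sum.elim prm a)
  have hg : ∀ j : J, ∃ g : Ge pE a, g • b = fun i => w (j, Sum.inl i) := by
    intro j
    refine exists_Ge_smul_eq hM hE hγ hι (w₀ := fun i => w (j, Sum.inr i))
      (SameTp.of_emb emb ?_) ?_
    · refine (sameTp_smul (f j : M' ≃[L] M') _).symm.trans
        (hw.symm.reindex (fun x => Sum.inl (j, x)) ?_ ?_)
      · rintro (i | i) <;> rfl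
      · rintro (i | i) <;> rfl
    · rw [← frel_emb emb]
      refine (hw.frel_iff (fun i => Sum.inr (Sum.inr i)) (fun i => Sum.inl (j, Sum.inr i))
        (fun _ => rfl) (fun _ => rfl) (fun _ => rfl) (fun _ => rfl)).2 (frel_smul_Ge hE' (f j))
  choose g hg using hg
  refine ⟨g, hw.reindex (Sum.map (fun p => (p.1, Sum.inl p.2)) Sum.inl) ?_ ?_⟩
  · rintro (p | p)
    · exact congrArg emb (congrFun (hg p.1) p.2)
    · rfl
  · rintro (p | p) <;> rfl

theorem exists_stabilizer_smul_eq (hM : IsMonster κ L M) {X ι : Type u} (hX : #X < κ)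
    (hι : #ι < κ) {b : ι → M} (hb : eInDclTuple pE a b) {c d : X → M}
    (h : SameTp (L := L) (Sum.elim c b) (Sum.elim d b)) :
    ∃ k ∈ MulAction.stabilizer (Ge pE a) b, k • c = d := by
  obtain ⟨f, hf⟩ := hM.exists_smul_eq (by simpa using add_lt_of_lt hM.1.le hX hι) h
  have h2 : ∀ i, f (b i) = b i := fun i => congrFun hf (Sum.inr i)
  exact ⟨⟨f, hb f h2⟩, funext h2, funext fun i => congrFun hf (Sum.inl i)⟩

theorem projT_eq_iff {g h : Ge pE a} :
    projT κ pE a g = projT κ pE a h ↔ g⁻¹ * h ∈ AutfL κ pE a := QuotientGroup.eq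

theorem projT_eq_of_sameTp (hM : IsMonster κ L M) {ι : Type u} (hι : #ι < κ) {b : ι → M}
    (hb : eInDclTuple pE a b) (hbL : MulAction.stabilizer (Ge pE a) b ≤ AutfL κ pE a)
    {g h : Ge pE a} (hgh : SameTp (L := L) (Sum.elim (g • b) b) (Sum.elim (h • b) b)) :
    projT κ pE a g = projT κ pE a h := by
  obtain ⟨k, hk, hkg⟩ := exists_stabilizer_smul_eq hM hι hι hb hgh
  have h1 : g⁻¹ * k⁻¹ * h ∈ AutfL κ pE a := hbL (by
    rw [MulAction.mem_stabilizer_iff, mul_smul, mul_smul, ← hkg, inv_smul_smul, inv_smul_smul])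
  have h2 := (AutfL_normal κ pE a).conj_mem _ (hbL hk) g⁻¹
  rw [projT_eq_iff]
  convert mul_mem h2 h1 using 1
  group

theorem eInDclTuple.of_fixes {ι : Type u} {b : ι → M} (hb : eInDclTuple pE a b)
    {f : M ≃[L] M} (hf : f • b = b) : f ∈ AutE pE a := hb f fun i => congrFun hf i

theorem eInDclTuple.smul {ι : Type u} {b : ι → M} (hb : eInDclTuple pE a b) (u : Ge pE a) :
    eInDclTuple pE a (u • b) := by
  intro g hg
  have h1 : (u : M ≃[L] M)⁻¹ * g * (u : M ≃[L] M) ∈ AutE pE a := by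
    refine hb.of_fixes ?_
    have : g • (u : M ≃[L] M) • b = (u : M ≃[L] M) • b := funext hg
    rw [mul_smul, mul_smul, this, inv_smul_smul]
  have h2 := mul_mem (mul_mem u.2 h1) (inv_mem u.2)
  convert h2 using 1
  group

theorem exists_ultrafilter_isTypeLim (S : L.ElementarySubstructure M) {ι : Type u} (b : ι → M) :
    ∃ 𝒰 : Ultrafilter (ι → S),
      IsTypeLim L 𝒰 (fun v => Sum.elim (fun i => (v i : M)) ((↑) : S → M))
        (Sum.elim b ((↑) : S → M)) := by
  classical
  let P : Set (L.Formula (ι ⊕ S)) := {φ | φ.Realize (Sum.elim b ((↑) : S → M))}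
  let D : L.Formula (ι ⊕ S) → Set (ι → S) := fun φ =>
    {v | φ.Realize (Sum.elim (fun i => (v i : M)) ((↑) : S → M))}
  have hD : ∀ φ ∈ P, (D φ).Nonempty := by
    intro φ hφ
    obtain ⟨w, hw⟩ := exists_realize_of_elementary S.subtype b id φ hφ
    refine ⟨w, ?_⟩
    rw [← S.subtype.map_formula, Sum.comp_elim] at hw
    exact hw
  obtain ⟨𝒰, h𝒰⟩ := Ultrafilter.exists_ultrafilter_of_finite_inter_nonempty (D '' P) (by
    intro T hT
    suffices h : ∃ φ ∈ P, D φ ⊆ ⋂₀ (T : Set (Set (ι → S))) by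
      obtain ⟨φ, hφ, hφT⟩ := h
      exact (hD φ hφ).mono hφT
    induction T using Finset.induction_on with
    | empty => exact ⟨⊤, by simp [P], by simp⟩
    | insert s T _ ih =>
      rw [Finset.coe_insert, Set.insert_subset_iff] at hT
      obtain ⟨φ, hφ, hφT⟩ := ih hT.2
      obtain ⟨ψ, hψ, rfl⟩ := hT.1
      refine ⟨ψ ⊓ φ, Language.Formula.realize_inf.2 ⟨hψ, hφ⟩, fun v hv => ?_⟩
      have hv' := Language.Formula.realize_inf.1 hv
      rw [Finset.coe_insert, Set.sInter_insert]
      exact ⟨hv'.1, hφT hv'.2⟩)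
  refine ⟨𝒰, fun φ => ⟨fun h => h𝒰 ⟨φ, h, rfl⟩, fun h => ?_⟩⟩
  by_contra hφ
  have hn : ∀ᶠ v in (𝒰 : Filter (ι → S)), v ∈ D φ.not :=
    h𝒰 ⟨φ.not, Language.Formula.realize_not.2 hφ, rfl⟩
  obtain ⟨v, hv, hv'⟩ := (hn.and h).exists
  exact Language.Formula.realize_not.1 hv hv'

theorem AutfL_le_normalClosure (hM : IsMonster κ L M) {ι : Type u} (hι : #ι < κ) {b : ι → M}
    (hb : eInDclTuple pE a b) :
    AutfL κ pE a ≤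
      Subgroup.normalClosure (MulAction.stabilizer (Ge pE a) b : Set (Ge pE a)) := by
  refine Subgroup.normalClosure_le_normal ?_
  rintro f ⟨S, hS, hSe, hfS⟩
  obtain ⟨𝒰, h𝒰⟩ := exists_ultrafilter_isTypeLim S b
  obtain ⟨w, hw⟩ := hM.exists_isTypeLim hι (π := S ⊕ (ι ⊕ ι))
    (by simpa using add_lt_of_lt hM.1.le hS (add_lt_of_lt hM.1.le hι hι)) 𝒰
    (fun v i => (v i : M)) (Sum.elim (↑) (Sum.elim b (f • b)))
  have hSdcl : eInDclTuple pE a ((↑) : S → M) := fun g hg => hSe g fun x hx => hg ⟨x, hx⟩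
  have h1 : IsTypeLim L 𝒰 (fun v => Sum.elim (fun i => (v i : M)) ((↑) : S → M))
      (Sum.elim w ((↑) : S → M)) :=
    hw.reindex (Sum.map id Sum.inl) (by rintro v (i | i) <;> rfl) (by rintro (i | i) <;> rfl)
  obtain ⟨h, -, hhw⟩ := exists_stabilizer_smul_eq hM hι hS hSdcl (h𝒰.sameTp h1)
  have h2 : IsTypeLim L 𝒰 (fun v => Sum.elim b (fun i => (v i : M))) (Sum.elim b w) :=
    hw.reindex (Sum.elim (fun i => Sum.inr (Sum.inr (Sum.inl i))) Sum.inl)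
      (by rintro v (i | i) <;> rfl) (by rintro (i | i) <;> rfl)
  have h3 : IsTypeLim L 𝒰 (fun v => Sum.elim (f • b) (fun i => (v i : M)))
      (Sum.elim (f • b) w) :=
    hw.reindex (Sum.elim (fun i => Sum.inr (Sum.inr (Sum.inr i))) Sum.inl)
      (by rintro v (i | i) <;> rfl) (by rintro (i | i) <;> rfl)
  have h4 : SameTp (L := L) (Sum.elim b w) (Sum.elim (f • b) w) := by
    refine h2.sameTp ((h3.congr (Eventually.of_forall fun v => ?_)))
    refine (sameTp_of_smul (f : M ≃[L] M) ?_).symm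
    rintro (i | i)
    · rfl
    · exact (hfS _ (v i).2).symm
  rw [← hhw] at h4
  obtain ⟨k, hk, hkb⟩ := exists_stabilizer_smul_eq hM hι hι (hb.smul h) h4
  have hn := Subgroup.normalClosure_normal
    (s := (MulAction.stabilizer (Ge pE a) b : Set (Ge pE a)))
  have h5 : h⁻¹ * k * h ∈ Subgroup.normalClosure
      (MulAction.stabilizer (Ge pE a) b : Set (Ge pE a)) := by
    refine Subgroup.subset_normalClosure ?_
    change (h⁻¹ * k * h) • b = b
    rw [mul_smul, mul_smul, MulAction.mem_stabilizer_iff.1 hk, inv_smul_smul]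
  have h6 : k⁻¹ * f ∈ Subgroup.normalClosure
      (MulAction.stabilizer (Ge pE a) b : Set (Ge pE a)) := by
    refine Subgroup.subset_normalClosure ?_
    change (k⁻¹ * f) • b = b
    rw [mul_smul, ← hkb, inv_smul_smul]
  have h7 := hn.conj_mem _ h5 h
  have h8 := mul_mem h7 h6
  rw [SetLike.mem_coe]
  convert h8 using 1
  group

/-- `P` is closed under limits of types over `b`: if `tp(g(b)/b)` is a limit of types
`tp(f(b)/b)` with `f ∈ P`, then `g ∈ P`. -/
def IsTypeClosed {ι : Type u} (b : ι → M) (P : Set (Ge pE a)) : Prop :=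
  ∀ (A : Type u) (𝒰 : Ultrafilter A) (f : A → Ge pE a) (g : Ge pE a),
    (∀ᶠ α in 𝒰, f α ∈ P) →
    IsTypeLim L 𝒰 (fun α => Sum.elim (f α • b) b) (Sum.elim (g • b) b) → g ∈ P

theorem IsTypeClosed.mem_of_sameTp {ι : Type u} {b : ι → M} {P : Set (Ge pE a)}
    (hP : IsTypeClosed b P) {g h : Ge pE a} (hh : h ∈ P)
    (hgh : SameTp (L := L) (Sum.elim (g • b) b) (Sum.elim (h • b) b)) : g ∈ P :=
  hP PUnit (pure PUnit.unit) (fun _ => h) g (Eventually.of_forall fun _ => hh) fun φ => by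
    rw [eventually_const]
    exact hgh φ

/-- A set of automorphisms which is a union of cosets of `Autf_L(𝔠, e)` and closed with
respect to a tuple is closed with respect to any tuple determining the coset. -/
theorem IsTypeClosed.change_tuple (hM : IsMonster κ L M)
    (hE : Equivalence (Frel (M := M) pE)) (hγ : #γ < κ) {ι ι' : Type u} (hι : #ι < κ)
    (hι' : #ι' < κ) {b : ι → M} {c : ι' → M} (hc : eInDclTuple pE a c)
    (hcL : MulAction.stabilizer (Ge pE a) c ≤ AutfL κ pE a) {P : Set (Ge pE a)}
    (hP : ∀ g h, projT κ pE a g = projT κ pE a h → g ∈ P → h ∈ P)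
    (hb : IsTypeClosed b P) : IsTypeClosed c P := by
  intro A 𝒰 f g hf hg
  have hιι' : #(ι ⊕ ι') < κ := by simpa using add_lt_of_lt hM.1.le hι hι'
  obtain ⟨h, hh⟩ := exists_Ge_isTypeLim hM hE hγ (J := PUnit)
    (mk_lt_aleph0.trans hM.1) hιι' hιι' 𝒰 (fun α _ => f α) (Sum.elim b c) (Sum.elim b c)
  have h1 : h PUnit.unit ∈ P := hb A 𝒰 f _ hf
    (hh.reindex (Sum.map (fun i => (PUnit.unit, Sum.inl i)) Sum.inl)
      (by rintro α (i | i) <;> rfl) (by rintro (i | i) <;> rfl))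
  have h2 : IsTypeLim L 𝒰 (fun α => Sum.elim (f α • c) c)
      (Sum.elim (h PUnit.unit • c) c) :=
    hh.reindex (Sum.map (fun i => (PUnit.unit, Sum.inr i)) Sum.inr)
      (by rintro α (i | i) <;> rfl) (by rintro (i | i) <;> rfl)
  exact hP _ _ (projT_eq_of_sameTp hM hι' hc hcL (h2.sameTp hg)) h1

/-- The automorphisms `h` such that `b` and `h(b)` are joined by at most `n` steps, each of
which fixes the type over a conjugate of `b`. -/
def lascarBall {ι : Type u} (b : ι → M) : ℕ → Set (Ge pE a)
  | 0 => MulAction.stabilizer (Ge pE a) b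
  | n + 1 => {h | ∃ d ∈ lascarBall b n, ∃ u : Ge pE a,
      SameTp (L := L) (Sum.elim (h • b) (u • b)) (Sum.elim (d • b) (u • b))}

theorem isTypeClosed_lascarBall (hM : IsMonster κ L M)
    (hE : Equivalence (Frel (M := M) pE)) (hγ : #γ < κ) {ι : Type u} (hι : #ι < κ)
    {b : ι → M} (hb : eInDclTuple pE a b) (n : ℕ) :
    IsTypeClosed b (lascarBall (pE := pE) (a := a) b n) := by
  induction n with
  | zero =>
    intro A 𝒰 f g hf hg
    exact funext fun i => hg.eq (i := Sum.inl i) (j := Sum.inr i)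
      (hf.mono fun α hα => congrFun hα i)
  | succ n ih =>
    intro A 𝒰 f g hf hg
    have hdu : ∀ α, ∃ d u : Ge pE a, f α ∈ lascarBall b (n + 1) →
        d ∈ lascarBall b n ∧
          SameTp (L := L) (Sum.elim (f α • b) (u • b)) (Sum.elim (d • b) (u • b)) := by
      intro α
      by_cases hα : f α ∈ lascarBall b (n + 1)
      · obtain ⟨d, hd, u, hu⟩ := hα
        exact ⟨d, u, fun _ => ⟨hd, hu⟩⟩
      · exact ⟨1, 1, fun h => absurd h hα⟩
    choose d u hdu using hdu
    obtain ⟨h, hh⟩ := exists_Ge_isTypeLim hM hE hγ (J := ULift (Fin 3))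
      (mk_lt_aleph0.trans hM.1) hι hι 𝒰 (fun α j => ![f α, d α, u α] j.down) b b
    have hf' : IsTypeLim L 𝒰 (fun α => Sum.elim (f α • b) b) (Sum.elim (h ⟨0⟩ • b) b) :=
      hh.reindex (Sum.map (fun i => (⟨0⟩, i)) id)
        (by rintro α (i | i) <;> rfl) (by rintro (i | i) <;> rfl)
    have hd' : IsTypeLim L 𝒰 (fun α => Sum.elim (d α • b) b) (Sum.elim (h ⟨1⟩ • b) b) :=
      hh.reindex (Sum.map (fun i => (⟨1⟩, i)) id)
        (by rintro α (i | i) <;> rfl) (by rintro (i | i) <;> rfl)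
    have hfu : IsTypeLim L 𝒰 (fun α => Sum.elim (f α • b) (u α • b))
        (Sum.elim (h ⟨0⟩ • b) (h ⟨2⟩ • b)) :=
      hh.reindex (Sum.elim (fun i => Sum.inl (⟨0⟩, i)) fun i => Sum.inl (⟨2⟩, i))
        (by rintro α (i | i) <;> rfl) (by rintro (i | i) <;> rfl)
    have hdu' : IsTypeLim L 𝒰 (fun α => Sum.elim (d α • b) (u α • b))
        (Sum.elim (h ⟨1⟩ • b) (h ⟨2⟩ • b)) :=
      hh.reindex (Sum.elim (fun i => Sum.inl (⟨1⟩, i)) fun i => Sum.inl (⟨2⟩, i))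
        (by rintro α (i | i) <;> rfl) (by rintro (i | i) <;> rfl)
    have h1 : h ⟨1⟩ ∈ lascarBall b n := ih A 𝒰 d _ (hf.mono fun α hα => (hdu α hα).1) hd'
    have h2 : SameTp (L := L) (Sum.elim (h ⟨0⟩ • b) (h ⟨2⟩ • b))
        (Sum.elim (h ⟨1⟩ • b) (h ⟨2⟩ • b)) :=
      (hfu.congr (hf.mono fun α hα => (hdu α hα).2)).sameTp hdu'
    obtain ⟨k, hk, hkg⟩ := exists_stabilizer_smul_eq hM hι hι hb (hf'.sameTp hg)
    refine ⟨k * h ⟨1⟩, ih.mem_of_sameTp h1 ?_, k * h ⟨2⟩, ?_⟩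
    · refine (sameTp_of_smul (k : M ≃[L] M) ?_).symm
      rintro (i | i)
      · rfl
      · exact (congrFun hk i).symm
    · rw [← hkg]
      refine ((sameTp_of_smul (k : M ≃[L] M) ?_).symm.trans h2).trans
        (sameTp_of_smul (k : M ≃[L] M) ?_)
      · rintro (i | i) <;> rfl
      · rintro (i | i) <;> rfl

theorem mul_mem_lascarBall {ι : Type u} {b : ι → M} {n : ℕ} {x u h : Ge pE a}
    (hx : x • u • b = u • b) (hh : h ∈ lascarBall b n) : x * h ∈ lascarBall b (n + 1) := by
  refine ⟨h, hh, u, (sameTp_of_smul (x : M ≃[L] M) ?_).symm⟩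
  rintro (i | i)
  · rfl
  · exact (congrFun hx i).symm

theorem stabilizer_smul_le_AutfL {ι : Type u} {b : ι → M}
    (hbL : MulAction.stabilizer (Ge pE a) b ≤ AutfL κ pE a) (u : Ge pE a) :
    MulAction.stabilizer (Ge pE a) (u • b) ≤ AutfL κ pE a := by
  intro k hk
  have h1 : u⁻¹ * k * u ∈ AutfL κ pE a := hbL (by
    rw [MulAction.mem_stabilizer_iff, mul_smul, mul_smul, MulAction.mem_stabilizer_iff.1 hk,
      inv_smul_smul])
  have h2 := (AutfL_normal κ pE a).conj_mem _ h1 u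
  convert h2 using 1
  group

theorem mem_AutfL_iff_lascarBall (hM : IsMonster κ L M) {ι : Type u} (hι : #ι < κ)
    {b : ι → M} (hb : eInDclTuple pE a b)
    (hbL : MulAction.stabilizer (Ge pE a) b ≤ AutfL κ pE a) {h : Ge pE a} :
    h ∈ AutfL κ pE a ↔ ∃ n, h ∈ lascarBall b n := by
  constructor
  · intro hh
    have h1 := AutfL_le_normalClosure hM hι hb hh
    rw [Subgroup.normalClosure] at h1
    have h2 : ∀ x ∈ Group.conjugatesOfSet
        (MulAction.stabilizer (Ge pE a) b : Set (Ge pE a)), ∃ u : Ge pE a,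
          x • u • b = u • b := by
      intro x hx
      obtain ⟨k, hk, hkx⟩ := Group.mem_conjugatesOfSet_iff.1 hx
      obtain ⟨u, rfl⟩ := isConj_iff.1 hkx
      refine ⟨u, ?_⟩
      rw [mul_smul, mul_smul, inv_smul_smul, MulAction.mem_stabilizer_iff.1 hk]
    induction h1 using Subgroup.closure_induction_left with
    | one => exact ⟨0, one_mem _⟩
    | mul_left x hx y hy ih =>
      obtain ⟨u, hu⟩ := h2 x hx
      obtain ⟨n, hn⟩ := ih (by
        have := Subgroup.normalClosure_le_normal (N := AutfL κ pE a) hbL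
        exact this hy)
      exact ⟨n + 1, mul_mem_lascarBall hu hn⟩
    | inv_mul_cancel x hx y hy ih =>
      obtain ⟨u, hu⟩ := h2 x hx
      obtain ⟨n, hn⟩ := ih (by
        have := Subgroup.normalClosure_le_normal (N := AutfL κ pE a) hbL
        exact this hy)
      exact ⟨n + 1, mul_mem_lascarBall (inv_smul_eq_iff.2 hu.symm) hn⟩
  · rintro ⟨n, hn⟩
    induction n generalizing h with
    | zero => exact hbL hn
    | succ n ih =>
      obtain ⟨d, hd, u, hu⟩ := hn
      obtain ⟨k, hk, hkh⟩ := exists_stabilizer_smul_eq hM hι hι (hb.smul u) hu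
      have h1 : d⁻¹ * (k * h) ∈ AutfL κ pE a := hbL (by
        rw [MulAction.mem_stabilizer_iff, mul_smul, mul_smul, hkh, inv_smul_smul])
      have h2 := mul_mem (inv_mem (stabilizer_smul_le_AutfL hbL u hk)) (mul_mem (ih hd) h1)
      convert h2 using 1
      group

theorem isClosed_galTopT_iff (hM : IsMonster κ L M) (N : L.ElementarySubstructure M)
    (hN : #N < κ) (hb : eInDclTuple pE a ((↑) : N → M))
    (hbL : MulAction.stabilizer (Ge pE a) ((↑) : N → M) ≤ AutfL κ pE a)
    (C : Set (GalT κ pE a)) :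
    @IsClosed _ (galTopT κ pE a N) C ↔ IsTypeClosed ((↑) : N → M) (projT κ pE a ⁻¹' C) := by
  let _ : TopologicalSpace (SMod pE a N) := typeSetTop (SMod pE a N)
  let tp : Ge pE a → SMod pE a N := fun g => ⟨tpOver ((↑) : N → M) (g • ((↑) : N → M)), g, rfl⟩
  have htp : ∀ g h, tp g = tp h → projT κ pE a g = projT κ pE a h := by
    intro g h hgh
    refine projT_eq_of_sameTp hM hN hb hbL fun φ => ?_
    exact Set.ext_iff.1 (Subtype.ext_iff.1 hgh) φ
  have hrep : ∀ p : SMod pE a N, ∃ g, tp g = p ∧ nuT κ pE a N p = projT κ pE a g :=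
    fun p => ⟨_, Subtype.ext (Set.mem_range.mp p.2).choose_spec, rfl⟩
  have hnu : ∀ g, nuT κ pE a N (tp g) = projT κ pE a g := by
    intro g
    obtain ⟨h, h1, h2⟩ := hrep (tp g)
    rw [h2, htp h g h1]
  have hnhds : ∀ (p : SMod pE a N) (𝒰 : Ultrafilter (SMod pE a N)), ↑𝒰 ≤ nhds p ↔
      ∀ φ, φ ∈ p.1 ↔ ∀ᶠ q : SMod pE a N in (𝒰 : Filter (SMod pE a N)), φ ∈ q.1 := by
    intro p 𝒰
    have h1 : ↑𝒰 ≤ nhds p ↔ ∀ φ, ∀ᶠ q : SMod pE a N in (𝒰 : Filter (SMod pE a N)),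
        q.1.boolIndicator φ = p.1.boolIndicator φ := by
      rw [show nhds p = _ from nhds_induced _ p, ← tendsto_iff_comap, tendsto_pi_nhds]
      simp only [nhds_discrete, tendsto_pure]
    rw [h1]
    refine forall_congr' fun φ => ?_
    by_cases hφ : φ ∈ p.1
    · simp only [hφ, true_iff]
      refine eventually_congr (Eventually.of_forall fun q => ?_)
      rw [(Set.mem_iff_boolIndicator _ _).1 hφ, ← Set.mem_iff_boolIndicator]
    · simp only [hφ, false_iff, ← Ultrafilter.eventually_not]
      refine eventually_congr (Eventually.of_forall fun q => ?_)
      rw [(Set.notMem_iff_boolIndicator _ _).1 hφ, ← Set.notMem_iff_boolIndicator]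
  rw [galTopT, isClosed_coinduced, isClosed_iff_ultrafilter]
  constructor
  · intro h A 𝒰 f g hf hg
    have := h (tp g) (𝒰.map fun α => tp (f α)) ((hnhds _ _).2 hg) ?_
    · rwa [Set.mem_preimage, hnu] at this
    · refine hf.mono fun α hα => ?_
      change nuT κ pE a N (tp (f α)) ∈ C
      rw [hnu]
      exact hα
  · intro h p 𝒰 hp hC
    choose r hr1 hr2 using hrep
    have := h (SMod pE a N) 𝒰 r (r p) ?_ ?_
    · rw [Set.mem_preimage, hr2]
      exact this
    · filter_upwards [hC] with q hq
      rw [Set.mem_preimage, hr2] at hq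
      exact hq
    · intro φ
      have h1 := (hnhds p 𝒰).1 hp φ
      rw [← hr1 p] at h1
      refine h1.trans (eventually_congr (Eventually.of_forall fun q => ?_))
      have : φ ∈ (tp (r q)).1 ↔ φ ∈ q.1 := by rw [hr1]
      exact this.symm


section Extension

variable {M' : Type u} [L.Structure M'] {emb : M ↪ₑ[L] M'} {κ' : Cardinal.{u}}

/-- The automorphism `f'` of the larger model extends the automorphism `f`. -/
def IsExt (emb : M ↪ₑ[L] M') (f : Ge pE a) (f' : Ge pE (⇑emb ∘ a)) : Prop :=
  ∀ x, (f' : M' ≃[L] M') (emb x) = emb ((f : M ≃[L] M) x)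

theorem IsExt.smul_comp {f : Ge pE a} {f' : Ge pE (⇑emb ∘ a)} (h : IsExt emb f f')
    {X : Type u} (c : X → M) : f' • (⇑emb ∘ c) = ⇑emb ∘ (f • c) := funext fun i => h (c i)

theorem IsExt.mul {f g : Ge pE a} {f' g' : Ge pE (⇑emb ∘ a)} (hf : IsExt emb f f')
    (hg : IsExt emb g g') : IsExt emb (f * g) (f' * g') := by
  intro x
  change (f' : M' ≃[L] M') ((g' : M' ≃[L] M') (emb x)) = _
  rw [hg, hf]
  rfl

theorem IsExt.inv {f : Ge pE a} {f' : Ge pE (⇑emb ∘ a)} (hf : IsExt emb f f') :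
    IsExt emb f⁻¹ f'⁻¹ := by
  intro x
  have h1 := hf ((f⁻¹ : Ge pE a) • x)
  change (f'⁻¹ : Ge pE (⇑emb ∘ a)) • emb x = emb ((f⁻¹ : Ge pE a) • x)
  rw [inv_smul_eq_iff]
  refine Eq.trans ?_ h1.symm
  change emb x = emb (f • (f⁻¹ : Ge pE a) • x)
  rw [smul_inv_smul]

theorem exists_isExt (hM' : IsMonster κ' L M') (hMs : #M < κ')
    (hE : Equivalence (Frel (M := M) pE)) (hE' : Equivalence (Frel (M := M') pE))
    (f : Ge pE a) : ∃ f' : Ge pE (⇑emb ∘ a), IsExt emb f f' := by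
  obtain ⟨F, hF⟩ := hM'.exists_smul_eq hMs
    (SameTp.map_emb emb (sameTp_of_smul (L := L) (f : M ≃[L] M) (c := id)
      (d := (f : M ≃[L] M)) fun _ => rfl))
  have hF' : ∀ x, F (emb x) = emb ((f : M ≃[L] M) x) := fun x => congrFun hF x
  refine ⟨⟨F, (mem_AutE_iff hE' F).2 ?_⟩, hF'⟩
  have : F • (⇑emb ∘ a) = ⇑emb ∘ (f • a) := funext fun i => hF' (a i)
  rw [this, frel_emb]
  exact frel_smul_Ge hE f

theorem IsTypeLim.map_emb {A X : Type u} {𝒰 : Ultrafilter A} {v : A → X → M} {w : X → M} :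
    IsTypeLim L 𝒰 (fun α => ⇑emb ∘ v α) (⇑emb ∘ w) ↔ IsTypeLim L 𝒰 v w :=
  forall_congr' fun φ => by simp only [emb.map_formula]

/-- A tuple `b` in the smaller of two monster models which determines the hyperimaginary
and, up to `Autf_L`, its automorphisms, in both models. -/
structure IsBaseTuple (κ κ' : Cardinal.{u}) (emb : M ↪ₑ[L] M') (pE : Set (L.Formula (γ ⊕ γ)))
    (a : γ → M) {ι : Type u} (b : ι → M) : Prop where
  monster : IsMonster κ L M
  monster' : IsMonster κ' L M'
  le : κ ≤ κ'
  mk_lt : #M < κ'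
  mk_rep_lt : #γ < κ
  equivalence : Equivalence (Frel (M := M) pE)
  equivalence' : Equivalence (Frel (M := M') pE)
  mk_index_lt : #ι < κ
  dcl : eInDclTuple pE a b
  stabilizer_le : MulAction.stabilizer (Ge pE a) b ≤ AutfL κ pE a
  dcl' : eInDclTuple pE (⇑emb ∘ a) (⇑emb ∘ b)
  stabilizer_le' : MulAction.stabilizer (Ge pE (⇑emb ∘ a)) (⇑emb ∘ b) ≤ AutfL κ' pE (⇑emb ∘ a)

namespace IsBaseTuple

variable {ι : Type u} {b : ι → M}

theorem exists_ext (H : IsBaseTuple κ κ' emb pE a b) (f : Ge pE a) : ∃ f' : Ge pE (⇑emb ∘ a), IsExt emb f f' :=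
  exists_isExt H.monster' H.mk_lt H.equivalence H.equivalence' f

theorem exists_sameTp (H : IsBaseTuple κ κ' emb pE a b) (f' : Ge pE (⇑emb ∘ a)) :
    ∃ f : Ge pE a,
    SameTp (L := L) (⇑emb ∘ Sum.elim (f • b) b) (Sum.elim (f' • (⇑emb ∘ b)) (⇑emb ∘ b)) := by
  obtain ⟨g, hg⟩ := exists_Ge_sameTp_emb H.monster H.equivalence H.mk_rep_lt emb H.equivalence'
    (J := PUnit) (mk_lt_aleph0.trans H.monster.1) H.mk_index_lt H.mk_index_lt (fun _ => f') b b
  exact ⟨g PUnit.unit, hg.reindex (Sum.map (fun i => (PUnit.unit, i)) id)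
    (by rintro (i | i) <;> rfl) (by rintro (i | i) <;> rfl)⟩

theorem exists_isExt_sameTp (H : IsBaseTuple κ κ' emb pE a b) (h' : Ge pE (⇑emb ∘ a)) :
    ∃ (h : Ge pE a) (h'' : Ge pE (⇑emb ∘ a)), IsExt emb h h'' ∧
      SameTp (L := L) (Sum.elim (h'' • (⇑emb ∘ b)) (⇑emb ∘ b))
        (Sum.elim (h' • (⇑emb ∘ b)) (⇑emb ∘ b)) := by
  obtain ⟨h, hh⟩ := H.exists_sameTp h'
  obtain ⟨h'', hext⟩ := H.exists_ext h
  refine ⟨h, h'', hext, ?_⟩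
  rwa [hext.smul_comp, ← Sum.comp_elim]

theorem mk_index_lt' (H : IsBaseTuple κ κ' emb pE a b) : #ι < κ' := H.mk_index_lt.trans_le H.le

theorem mk_rep_lt' (H : IsBaseTuple κ κ' emb pE a b) : #γ < κ' := H.mk_rep_lt.trans_le H.le

theorem projT_eq' (H : IsBaseTuple κ κ' emb pE a b) {g' h' : Ge pE (⇑emb ∘ a)}
    (h : SameTp (L := L) (Sum.elim (g' • (⇑emb ∘ b)) (⇑emb ∘ b))
      (Sum.elim (h' • (⇑emb ∘ b)) (⇑emb ∘ b))) :
    projT κ' pE (⇑emb ∘ a) g' = projT κ' pE (⇑emb ∘ a) h' :=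
  projT_eq_of_sameTp H.monster' H.mk_index_lt' H.dcl' H.stabilizer_le' h

theorem mem_lascarBall_of_sameTp (H : IsBaseTuple κ κ' emb pE a b) {n : ℕ} {h : Ge pE a}
    {h' : Ge pE (⇑emb ∘ a)} (hh' : h' ∈ lascarBall (⇑emb ∘ b) n)
    (hh : SameTp (L := L) (⇑emb ∘ Sum.elim (h • b) b)
      (Sum.elim (h' • (⇑emb ∘ b)) (⇑emb ∘ b))) : h ∈ lascarBall b n := by
  induction n generalizing h h' with
  | zero =>
    refine funext fun i => emb.injective ?_
    exact (hh.eq_iff (Sum.inl i) (Sum.inr i)).2 (congrFun hh' i)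
  | succ n ih =>
    obtain ⟨d', hd', u', hu'⟩ := hh'
    obtain ⟨g, hg⟩ := exists_Ge_sameTp_emb H.monster H.equivalence H.mk_rep_lt emb
      H.equivalence' (J := ULift (Fin 3)) (mk_lt_aleph0.trans H.monster.1) H.mk_index_lt
      H.mk_index_lt (fun j => ![h', d', u'] j.down) b b
    have h0 : SameTp (L := L) (⇑emb ∘ Sum.elim (g ⟨0⟩ • b) b)
        (Sum.elim (h' • (⇑emb ∘ b)) (⇑emb ∘ b)) :=
      hg.reindex (Sum.map (fun i => (⟨0⟩, i)) id)
        (by rintro (i | i) <;> rfl) (by rintro (i | i) <;> rfl)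
    have h1 : SameTp (L := L) (⇑emb ∘ Sum.elim (g ⟨1⟩ • b) b)
        (Sum.elim (d' • (⇑emb ∘ b)) (⇑emb ∘ b)) :=
      hg.reindex (Sum.map (fun i => (⟨1⟩, i)) id)
        (by rintro (i | i) <;> rfl) (by rintro (i | i) <;> rfl)
    have h02 : SameTp (L := L) (⇑emb ∘ Sum.elim (g ⟨0⟩ • b) (g ⟨2⟩ • b))
        (Sum.elim (h' • (⇑emb ∘ b)) (u' • (⇑emb ∘ b))) :=
      hg.reindex (Sum.elim (fun i => Sum.inl (⟨0⟩, i)) fun i => Sum.inl (⟨2⟩, i))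
        (by rintro (i | i) <;> rfl) (by rintro (i | i) <;> rfl)
    have h12 : SameTp (L := L) (⇑emb ∘ Sum.elim (g ⟨1⟩ • b) (g ⟨2⟩ • b))
        (Sum.elim (d' • (⇑emb ∘ b)) (u' • (⇑emb ∘ b))) :=
      hg.reindex (Sum.elim (fun i => Sum.inl (⟨1⟩, i)) fun i => Sum.inl (⟨2⟩, i))
        (by rintro (i | i) <;> rfl) (by rintro (i | i) <;> rfl)
    have h3 : g ⟨0⟩ ∈ lascarBall b (n + 1) :=
      ⟨g ⟨1⟩, ih hd' h1, g ⟨2⟩, ((h02.trans hu').trans h12.symm).of_emb⟩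
    exact (isTypeClosed_lascarBall H.monster H.equivalence H.mk_rep_lt H.mk_index_lt H.dcl
      (n + 1)).mem_of_sameTp h3 (hh.trans h0.symm).of_emb

theorem mem_lascarBall_iff (H : IsBaseTuple κ κ' emb pE a b) {n : ℕ} {h : Ge pE a}
    {h' : Ge pE (⇑emb ∘ a)} (hext : IsExt emb h h') :
    h ∈ lascarBall b n ↔ h' ∈ lascarBall (⇑emb ∘ b) n := by
  constructor
  · intro hh
    induction n generalizing h h' with
    | zero =>
      refine (hext.smul_comp b).trans ?_
      rw [MulAction.mem_stabilizer_iff.1 hh]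
    | succ n ih =>
      obtain ⟨d, hd, u, hu⟩ := hh
      obtain ⟨d', hdd'⟩ := H.exists_ext d
      obtain ⟨u', huu'⟩ := H.exists_ext u
      refine ⟨d', ih hdd' hd, u', ?_⟩
      rw [hext.smul_comp, hdd'.smul_comp, huu'.smul_comp, ← Sum.comp_elim, ← Sum.comp_elim]
      exact hu.map_emb emb
  · intro hh
    refine H.mem_lascarBall_of_sameTp hh ?_
    rw [hext.smul_comp, ← Sum.comp_elim]
    exact SameTp.refl _

theorem mem_AutfL_iff (H : IsBaseTuple κ κ' emb pE a b) {h : Ge pE a}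
    {h' : Ge pE (⇑emb ∘ a)} (hext : IsExt emb h h') :
    h ∈ AutfL κ pE a ↔ h' ∈ AutfL κ' pE (⇑emb ∘ a) := by
  rw [mem_AutfL_iff_lascarBall H.monster H.mk_index_lt H.dcl H.stabilizer_le,
    mem_AutfL_iff_lascarBall H.monster' H.mk_index_lt' H.dcl' H.stabilizer_le']
  exact exists_congr fun n => H.mem_lascarBall_iff hext

/-- The isomorphism between the Lascar groups of the two models, as a bijection. -/
theorem exists_galT_equiv (H : IsBaseTuple κ κ' emb pE a b) :
    ∃ Θ : GalT κ pE a ≃ GalT κ' pE (⇑emb ∘ a), ∀ f f', IsExt emb f f' →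
      Θ (projT κ pE a f) = projT κ' pE (⇑emb ∘ a) f' := by
  have hiff : ∀ {f g : Ge pE a} {f' g' : Ge pE (⇑emb ∘ a)}, IsExt emb f f' → IsExt emb g g' →
      (projT κ pE a f = projT κ pE a g ↔
        projT κ' pE (⇑emb ∘ a) f' = projT κ' pE (⇑emb ∘ a) g') := by
    intro f g f' g' hf hg
    rw [projT_eq_iff, projT_eq_iff]
    exact H.mem_AutfL_iff (hf.inv.mul hg)
  choose e he using H.exists_ext
  have hsurj : Function.Surjective (projT κ pE a) := QuotientGroup.mk_surjective
  choose s hs using hsurj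
  have hext : ∀ f f', IsExt emb f f' → projT κ' pE (⇑emb ∘ a) (e (s (projT κ pE a f))) =
      projT κ' pE (⇑emb ∘ a) f' := fun f f' hf => (hiff (he _) hf).1 (hs _)
  refine ⟨Equiv.ofBijective (fun q => projT κ' pE (⇑emb ∘ a) (e (s q))) ⟨?_, ?_⟩, hext⟩
  · intro p q hpq
    rw [← hs p, ← hs q]
    exact (hiff (he _) (he _)).2 hpq
  · intro q
    obtain ⟨h', rfl⟩ := QuotientGroup.mk_surjective q
    obtain ⟨h, h'', h1, h2⟩ := H.exists_isExt_sameTp h'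
    exact ⟨projT κ pE a h, (hext h h'' h1).trans (H.projT_eq' h2)⟩

theorem isTypeClosed_iff (H : IsBaseTuple κ κ' emb pE a b) {P : Set (Ge pE a)}
    {P' : Set (Ge pE (⇑emb ∘ a))}
    (hP' : ∀ g h, projT κ' pE (⇑emb ∘ a) g = projT κ' pE (⇑emb ∘ a) h → g ∈ P' → h ∈ P')
    (hPP' : ∀ f f', IsExt emb f f' → (f ∈ P ↔ f' ∈ P')) :
    IsTypeClosed b P ↔ IsTypeClosed (⇑emb ∘ b) P' := by
  constructor
  · intro h A 𝒰 f g hf hg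
    choose r r' hr hr' using H.exists_isExt_sameTp
    have h1 : r g ∈ P := by
      refine h A 𝒰 (fun α => r (f α)) (r g) (hf.mono fun α hα => ?_) ?_
      · exact (hPP' _ _ (hr _)).2 (hP' _ _ (H.projT_eq' (hr' _)).symm hα)
      · rw [← IsTypeLim.map_emb (emb := emb)]
        have h2 := hg.congr (Eventually.of_forall fun α => (hr' (f α)).symm)
        simp only [(hr _).smul_comp, ← Sum.comp_elim] at h2 hr'
        intro φ
        rw [← h2 φ, ← hr' g φ]
    exact hP' _ _ (H.projT_eq' (hr' g)) ((hPP' _ _ (hr g)).1 h1)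
  · intro h A 𝒰 f g hf hg
    choose e he using H.exists_ext
    refine (hPP' _ _ (he g)).2 (h A 𝒰 (fun α => e (f α)) (e g)
      (hf.mono fun α hα => (hPP' _ _ (he _)).1 hα) ?_)
    simp only [(he _).smul_comp, ← Sum.comp_elim]
    exact IsTypeLim.map_emb.2 hg

end IsBaseTuple
end Extension

section Topology

variable {M' : Type u} [L.Structure M'] {emb : M ↪ₑ[L] M'} {κ' : Cardinal.{u}}

theorem eInDclTuple.map_emb (hM : IsMonster κ L M) (hE : Equivalence (Frel (M := M) pE))
    (hE' : Equivalence (Frel (M := M') pE)) (hγ : #γ < κ) {ι : Type u} (hι : #ι < κ)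
    {b : ι → M} (hb : eInDclTuple pE a b) : eInDclTuple pE (⇑emb ∘ a) (⇑emb ∘ b) := by
  intro g hg
  obtain ⟨w, hw⟩ := hM.exists_sameTp_emb emb hγ (π := ι ⊕ γ)
    (by simpa using add_lt_of_lt hM.1.le hι hγ) (g • (⇑emb ∘ a)) (Sum.elim b a)
  have h1 : SameTp (L := L) (⇑emb ∘ Sum.elim w b) (Sum.elim (g • (⇑emb ∘ a)) (⇑emb ∘ b)) :=
    hw.reindex (Sum.map id Sum.inl) (by rintro (i | i) <;> rfl) (by rintro (i | i) <;> rfl)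
  have h2 : SameTp (L := L) (⇑emb ∘ Sum.elim a b) (Sum.elim (g • (⇑emb ∘ a)) (⇑emb ∘ b)) := by
    refine sameTp_of_smul g ?_
    rintro (i | i)
    · rfl
    · exact (hg i).symm
  obtain ⟨k, -, hk⟩ := exists_stabilizer_smul_eq hM hγ hι hb (h2.trans h1.symm).of_emb
  have h3 : Frel pE a w := hk ▸ frel_smul_Ge hE k
  rw [mem_AutE_iff hE']
  refine (hw.frel_iff (fun i => Sum.inr (Sum.inr i)) Sum.inl (fun _ => rfl) (fun _ => rfl)
    (fun _ => rfl) (fun _ => rfl)).1 ((frel_emb emb a w).2 h3)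

theorem stabilizer_coe_le_AutfL (N : L.ElementarySubstructure M) (hN : #N < κ)
    (hNdcl : eInDclTuple pE a ((↑) : N → M)) :
    MulAction.stabilizer (Ge pE a) ((↑) : N → M) ≤ AutfL κ pE a := by
  intro f hf
  exact Subgroup.subset_normalClosure ⟨N, hN, fun g hg => hNdcl g fun i => hg i i.2,
    fun x hx => congrFun hf ⟨x, hx⟩⟩

/-- The image of an elementary substructure under an elementary embedding. -/
def mapElementarySubstructure (emb : M ↪ₑ[L] M') (S : L.ElementarySubstructure M) :
    L.ElementarySubstructure M' where
  toSubstructure := (emb.comp S.subtype).toEmbedding.toHom.range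
  isElementary' := by
    intro n φ x
    let e := (emb.comp S.subtype).toEmbedding.equivRange
    obtain ⟨y, rfl⟩ : ∃ y : Fin n → S, x = e ∘ y := ⟨e.symm ∘ x,
      funext fun i => (e.apply_symm_apply (x i)).symm⟩
    rw [Language.StrongHomClass.realize_formula e φ, ← (emb.comp S.subtype).map_formula]
    rfl

theorem isBaseTuple_coe (hM : IsMonster κ L M) (hM' : IsMonster κ' L M') (hκ : κ ≤ κ')
    (hMs : #M < κ') (hγ : #γ < κ) (hE : Equivalence (Frel (M := M) pE))
    (hE' : Equivalence (Frel (M := M') pE)) (N : L.ElementarySubstructure M) (hN : #N < κ)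
    (hNdcl : eInDclTuple pE a ((↑) : N → M)) :
    IsBaseTuple κ κ' emb pE a ((↑) : N → M) where
  monster := hM
  monster' := hM'
  le := hκ
  mk_lt := hMs
  mk_rep_lt := hγ
  equivalence := hE
  equivalence' := hE'
  mk_index_lt := hN
  dcl := hNdcl
  stabilizer_le := stabilizer_coe_le_AutfL N hN hNdcl
  dcl' := hNdcl.map_emb hM hE hE' hγ hN
  stabilizer_le' := by
    have hmem : ∀ x : N, emb x ∈ mapElementarySubstructure emb N := fun x => ⟨x, rfl⟩
    have hcard : #(mapElementarySubstructure emb N) ≤ #N :=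
      Cardinal.mk_le_of_surjective (f := fun x : N => ⟨emb x, hmem x⟩) (by
        rintro ⟨y, x, rfl⟩
        exact ⟨x, rfl⟩)
    intro f hf
    refine stabilizer_coe_le_AutfL (mapElementarySubstructure emb N)
      (hcard.trans_lt (hN.trans_le hκ)) ?_ ?_
    · exact fun g hg => hNdcl.map_emb hM hE hE' hγ hN g fun x => hg ⟨emb x, hmem x⟩
    · refine funext ?_
      rintro ⟨y, x, rfl⟩
      exact congrFun hf x

theorem mem_connectedComponent_homeomorph_iff {X Y : Type u} [TopologicalSpace X]
    [TopologicalSpace Y] (h : X ≃ₜ Y) {x y : X} :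
    h y ∈ connectedComponent (h x) ↔ y ∈ connectedComponent x := by
  constructor
  · intro hy
    have := h.symm.continuous.image_connectedComponent_subset (h x) ⟨_, hy, rfl⟩
    simpa using this
  · exact fun hy => h.continuous.image_connectedComponent_subset x ⟨_, hy, rfl⟩

namespace IsBaseTuple

variable {N : L.ElementarySubstructure M} {N' : L.ElementarySubstructure M'}

theorem isTypeClosed_preimage_iff (H : IsBaseTuple κ κ' emb pE a ((↑) : N → M)) (hN' : #N' < κ')
    (hN'dcl : eInDclTuple pE (⇑emb ∘ a) ((↑) : N' → M'))
    (C : Set (GalT κ' pE (⇑emb ∘ a))) :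
    IsTypeClosed (⇑emb ∘ ((↑) : N → M)) (projT κ' pE (⇑emb ∘ a) ⁻¹' C) ↔
      @IsClosed _ (galTopT κ' pE (⇑emb ∘ a) N') C := by
  have hsat : ∀ g h, projT κ' pE (⇑emb ∘ a) g = projT κ' pE (⇑emb ∘ a) h →
      g ∈ projT κ' pE (⇑emb ∘ a) ⁻¹' C → h ∈ projT κ' pE (⇑emb ∘ a) ⁻¹' C := by
    intro g h hgh hg
    rwa [Set.mem_preimage, ← hgh]
  have hL := stabilizer_coe_le_AutfL N' hN' hN'dcl
  rw [isClosed_galTopT_iff H.monster' N' hN' hN'dcl hL]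
  exact ⟨fun h => h.change_tuple H.monster' H.equivalence' H.mk_rep_lt' H.mk_index_lt' hN'
      hN'dcl hL hsat,
    fun h => h.change_tuple H.monster' H.equivalence' H.mk_rep_lt' hN' H.mk_index_lt'
      H.dcl' H.stabilizer_le' hsat⟩

theorem exists_galT_homeomorph (H : IsBaseTuple κ κ' emb pE a ((↑) : N → M)) (hN' : #N' < κ')
    (hN'dcl : eInDclTuple pE (⇑emb ∘ a) ((↑) : N' → M')) :
    ∃ Θ : @Homeomorph (GalT κ pE a) (GalT κ' pE (⇑emb ∘ a)) (galTopT κ pE a N)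
      (galTopT κ' pE (⇑emb ∘ a) N'), ∀ f f', IsExt emb f f' →
      Θ (projT κ pE a f) = projT κ' pE (⇑emb ∘ a) f' := by
  obtain ⟨Θ, hΘ⟩ := H.exists_galT_equiv
  have hclosed : ∀ C, @IsClosed _ (galTopT κ pE a N) (Θ ⁻¹' C) ↔
      @IsClosed _ (galTopT κ' pE (⇑emb ∘ a) N') C := by
    intro C
    rw [isClosed_galTopT_iff H.monster N H.mk_index_lt H.dcl H.stabilizer_le,
      ← H.isTypeClosed_preimage_iff hN' hN'dcl]
    refine H.isTypeClosed_iff ?_ ?_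
    · intro g h hgh hg
      rwa [Set.mem_preimage, ← hgh]
    · intro f f' hff'
      rw [Set.mem_preimage, Set.mem_preimage, hΘ f f' hff', Set.mem_preimage]
  let _ := galTopT κ pE a N
  let _ := galTopT κ' pE (⇑emb ∘ a) N'
  refine ⟨Θ.toHomeomorph fun s => ?_, hΘ⟩
  rw [← isClosed_compl_iff, ← Set.preimage_compl, hclosed, isClosed_compl_iff]

theorem mem_AutfKPset_iff (H : IsBaseTuple κ κ' emb pE a ((↑) : N → M)) (hN' : #N' < κ')
    (hN'dcl : eInDclTuple pE (⇑emb ∘ a) ((↑) : N' → M')) {f : Ge pE a}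
    {f' : Ge pE (⇑emb ∘ a)} (hf : IsExt emb f f') :
    f ∈ AutfKPset κ pE a N ↔ f' ∈ AutfKPset κ' pE (⇑emb ∘ a) N' := by
  obtain ⟨Θ, hΘ⟩ := H.exists_galT_homeomorph hN' hN'dcl
  let _ := galTopT κ pE a N
  let _ := galTopT κ' pE (⇑emb ∘ a) N'
  have h1 := hΘ 1 1 fun _ => rfl
  change projT κ pE a f ∈ closure {projT κ pE a 1} ↔
    projT κ' pE (⇑emb ∘ a) f' ∈ closure {projT κ' pE (⇑emb ∘ a) 1}
  rw [← hΘ f f' hf, ← h1, ← Set.image_singleton (f := Θ), ← Θ.image_closure,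
    Θ.injective.mem_set_image]

theorem mem_AutfSset_iff (H : IsBaseTuple κ κ' emb pE a ((↑) : N → M)) (hN' : #N' < κ')
    (hN'dcl : eInDclTuple pE (⇑emb ∘ a) ((↑) : N' → M')) {f : Ge pE a}
    {f' : Ge pE (⇑emb ∘ a)} (hf : IsExt emb f f') :
    f ∈ AutfSset κ pE a N ↔ f' ∈ AutfSset κ' pE (⇑emb ∘ a) N' := by
  obtain ⟨Θ, hΘ⟩ := H.exists_galT_homeomorph hN' hN'dcl
  let _ := galTopT κ pE a N
  let _ := galTopT κ' pE (⇑emb ∘ a) N'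
  have h1 := hΘ 1 1 fun _ => rfl
  change projT κ pE a f ∈ connectedComponent (projT κ pE a 1) ↔
    projT κ' pE (⇑emb ∘ a) f' ∈ connectedComponent (projT κ' pE (⇑emb ∘ a) 1)
  rw [← hΘ f f' hf, ← h1, mem_connectedComponent_homeomorph_iff]

theorem isTypeClosed_AutfKPset (H : IsBaseTuple κ κ' emb pE a ((↑) : N → M)) (hN' : #N' < κ')
    (hN'dcl : eInDclTuple pE (⇑emb ∘ a) ((↑) : N' → M')) :
    IsTypeClosed (⇑emb ∘ ((↑) : N → M)) (AutfKPset κ' pE (⇑emb ∘ a) N') :=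
  (H.isTypeClosed_preimage_iff hN' hN'dcl _).2 (@isClosed_closure _ (galTopT _ _ _ _) _)

theorem isTypeClosed_AutfSset (H : IsBaseTuple κ κ' emb pE a ((↑) : N → M)) (hN' : #N' < κ')
    (hN'dcl : eInDclTuple pE (⇑emb ∘ a) ((↑) : N' → M')) :
    IsTypeClosed (⇑emb ∘ ((↑) : N → M)) (AutfSset κ' pE (⇑emb ∘ a) N') :=
  (H.isTypeClosed_preimage_iff hN' hN'dcl _).2
    (@isClosed_connectedComponent _ (galTopT _ _ _ _) _)

end IsBaseTuple
end Topology

section Relative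

variable {V β : Type u} {pS : Set (L.Formula (V ⊕ β))} {bp : β → M}

/-- The restricted automorphisms which agree on each small tuple of realizations with an
element of `K`. -/
def agreeSet (κ : Cardinal.{u}) (hInv : SolInv pE a pS bp) (K : Set (Ge pE a)) :
    Set (GS pE a hInv) :=
  {σ | ∀ ι : Type u, #ι < κ → ∀ c : ι → SolT pS bp, ∃ h ∈ K, h • flat c = flat (σ • c)}

theorem mul_mem_agreeSet {hInv : SolInv pE a pS bp} {K : Set (Ge pE a)}
    (hK : ∀ h ∈ K, ∀ x ∈ AutfL κ pE a, h * x ∈ K) {σ l : GS pE a hInv}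
    (hσ : σ ∈ agreeSet κ hInv K) (hl : l ∈ AutfLS κ pE a hInv) :
    σ * l ∈ agreeSet κ hInv K := by
  intro ι hι c
  obtain ⟨x, hx, hxc⟩ := hl ι hι c
  obtain ⟨h, hh, hhc⟩ := hσ ι hι (l • c)
  exact ⟨h * x, hK h hh x hx, by rw [mul_smul, hxc, hhc, mul_smul]⟩

theorem mul_mem_preimage_projT {C : Set (GalT κ pE a)} {h x : Ge pE a}
    (hh : h ∈ projT κ pE a ⁻¹' C) (hx : x ∈ AutfL κ pE a) : h * x ∈ projT κ pE a ⁻¹' C := by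
  have : projT κ pE a h = projT κ pE a (h * x) := by
    rw [projT_eq_iff, inv_mul_cancel_left]
    exact hx
  rwa [Set.mem_preimage, ← this]

variable {M' : Type u} [L.Structure M'] {emb : M ↪ₑ[L] M'} {κ' : Cardinal.{u}}

theorem comp_mem_solSet_iff {v : V → M} : ⇑emb ∘ v ∈ SolSet pS (⇑emb ∘ bp) ↔ v ∈ SolSet pS bp :=
  forall₂_congr fun φ _ => by rw [← Sum.comp_elim, emb.map_formula]

theorem SameTp.mem_solSet {X : Type u} {c d : X → M} (h : SameTp (L := L) c d) (r : V → X)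
    (s : β → X) {v : V → M} {prm : β → M} (hv : v ∈ SolSet pS prm) (hvc : ∀ i, v i = c (r i))
    (hprm : ∀ i, prm i = c (s i)) : d ∘ r ∈ SolSet pS (d ∘ s) := by
  intro φ hφ
  refine (h.reindex (c' := Sum.elim v prm) (d' := Sum.elim (d ∘ r) (d ∘ s)) (Sum.elim r s)
    ?_ ?_ φ).1 (hv φ hφ)
  · rintro (i | i) <;> simp [hvc, hprm]
  · rintro (i | i) <;> rfl

namespace IsBaseTuple

variable {ι : Type u} {b : ι → M}

theorem agree_of_agree' (H : IsBaseTuple κ κ' emb pE a b) (hV : #V < κ)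
    {P : Set (Ge pE a)} {P' : Set (Ge pE (⇑emb ∘ a))}
    (hPP' : ∀ h h', IsExt emb h h' → (h ∈ P ↔ h' ∈ P')) (hP' : IsTypeClosed (⇑emb ∘ b) P')
    {f : Ge pE a} {f' : Ge pE (⇑emb ∘ a)} (hf : IsExt emb f f') {X : Type u} (hX : #X < κ)
    (c : X × V → M) {h' : Ge pE (⇑emb ∘ a)} (hh' : h' ∈ P')
    (hc : h' • (⇑emb ∘ c) = f' • (⇑emb ∘ c)) : ∃ h ∈ P, h • c = f • c := by
  have hcard : #(ι ⊕ X × V) < κ := by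
    simpa using add_lt_of_lt H.monster.1.le H.mk_index_lt (mul_lt_of_lt H.monster.1.le hX hV)
  obtain ⟨g, hg⟩ := exists_Ge_sameTp_emb H.monster H.equivalence H.mk_rep_lt emb
    H.equivalence' (J := PUnit) (mk_lt_aleph0.trans H.monster.1) hcard hcard (fun _ => h')
    (Sum.elim b c) (Sum.elim b (f • c))
  refine ⟨g PUnit.unit, ?_, funext fun i => emb.injective ?_⟩
  · obtain ⟨g', hg'⟩ := H.exists_ext (g PUnit.unit)
    refine (hPP' _ _ hg').2 (hP'.mem_of_sameTp hh' ?_)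
    rw [hg'.smul_comp]
    exact hg.reindex (Sum.map (fun i => (PUnit.unit, Sum.inl i)) Sum.inl)
      (by rintro (i | i) <;> rfl) (by rintro (i | i) <;> rfl)
  · refine (hg.eq_iff (Sum.inl (PUnit.unit, Sum.inr i)) (Sum.inr (Sum.inr i))).2 ?_
    exact (congrFun hc i).trans (hf (c i))

/-- If `f` agrees on every small tuple of realizations with an element of some `P n`,
then `n` can be chosen uniformly for finite tuples. -/
theorem exists_uniform_agree (hκ : ℵ₀ < κ) {P : ℕ → Set (Ge pE a)} {f : Ge pE a}
    (hf : ∀ X : Type u, #X < κ → ∀ c : X → SolT pS bp, ∃ n, ∃ h ∈ P n, h • flat c = f • flat c) :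
    ∃ n, ∀ X : Type u, Finite X → ∀ c : X → SolT pS bp, ∃ h ∈ P n, h • flat c = f • flat c := by
  by_contra! hcon
  choose X hX c hc using hcon
  obtain ⟨n, h, hh, hfc⟩ := hf (Σ n, X n) (mk_le_aleph0.trans_lt hκ) fun p => c p.1 p.2
  exact hc n h hh (funext fun p => congrFun hfc (⟨n, p.1⟩, p.2))

theorem agree'_of_agree_finite (H : IsBaseTuple κ κ' emb pE a b) (hV : #V < κ) (hβ : #β < κ)
    {P : Set (Ge pE a)} {P' Q' : Set (Ge pE (⇑emb ∘ a))}
    (hPP' : ∀ h h', IsExt emb h h' → (h ∈ P ↔ h' ∈ P'))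
    (hQ' : ∀ h ∈ P', ∀ f g₁ g₂ : Ge pE (⇑emb ∘ a),
      g₁ ∈ MulAction.stabilizer (Ge pE (⇑emb ∘ a)) (⇑emb ∘ b) →
      g₂ ∈ MulAction.stabilizer (Ge pE (⇑emb ∘ a)) (⇑emb ∘ b) → f * g₁ * f⁻¹ * (h * g₂) ∈ Q')
    {f : Ge pE a} {f' : Ge pE (⇑emb ∘ a)} (hf : IsExt emb f f') {X : Type u} (hX : #X < κ)
    (hPf : ∀ c : X → SolT pS bp, ∃ h ∈ P, h • flat c = f • flat c)
    (c' : X → SolT pS (⇑emb ∘ bp)) : ∃ h' ∈ Q', h' • flat c' = f' • flat c' := by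
  have hXV : #(X × V) < κ := by simpa using mul_lt_of_lt H.monster.1.le hX hV
  obtain ⟨w, hw⟩ := H.monster.exists_sameTp_emb emb hXV (π := ι ⊕ β)
    (by simpa using add_lt_of_lt H.monster.1.le H.mk_index_lt hβ) (flat c') (Sum.elim b bp)
  have hmem : ∀ x : X, (fun v => w (x, v)) ∈ SolSet pS bp := fun x =>
    comp_mem_solSet_iff.1 (hw.symm.mem_solSet (fun v => Sum.inl (x, v))
      (fun i => Sum.inr (Sum.inr i)) (c' x).2 (fun _ => rfl) (fun _ => rfl))
  obtain ⟨h, hh, hhw⟩ := hPf fun x => ⟨_, hmem x⟩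
  change h • w = f • w at hhw
  obtain ⟨h', hext⟩ := H.exists_ext h
  have h1 : SameTp (L := L) (Sum.elim (⇑emb ∘ w) (⇑emb ∘ b)) (Sum.elim (flat c') (⇑emb ∘ b)) :=
    hw.reindex (Sum.map id Sum.inl) (by rintro (i | i) <;> rfl) (by rintro (i | i) <;> rfl)
  obtain ⟨g, hg, hgw⟩ := exists_stabilizer_smul_eq H.monster' (hXV.trans_le H.le)
    H.mk_index_lt' H.dcl' h1
  refine ⟨_, hQ' h' ((hPP' h h' hext).1 hh) f' g g⁻¹ hg (inv_mem hg), ?_⟩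
  rw [← hgw, mul_smul, mul_smul, mul_smul, mul_smul, inv_smul_smul, hext.smul_comp, hhw,
    ← hf.smul_comp, inv_smul_smul]

theorem agree'_of_finite (H : IsBaseTuple κ κ' emb pE a b) (hV : #V < κ)
    {P' : Set (Ge pE (⇑emb ∘ a))} (hP' : IsTypeClosed (⇑emb ∘ b) P') {f' : Ge pE (⇑emb ∘ a)}
    (hfin : ∀ X : Type u, Finite X → ∀ c' : X → SolT pS (⇑emb ∘ bp),
      ∃ h' ∈ P', h' • flat c' = f' • flat c') {X : Type u} (hX : #X < κ')
    (c' : X → SolT pS (⇑emb ∘ bp)) : ∃ h' ∈ P', h' • flat c' = f' • flat c' := by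
  classical
  choose h' hh' hc' using fun s : Finset X => hfin s inferInstance fun i => c' i
  have hcard : #(ι ⊕ X × V) < κ' := by
    simpa using add_lt_of_lt H.monster'.1.le H.mk_index_lt'
      (mul_lt_of_lt H.monster'.1.le hX (hV.trans_le H.le))
  obtain ⟨g, hg⟩ := exists_Ge_isTypeLim H.monster' H.equivalence' H.mk_rep_lt' (J := PUnit)
    (mk_lt_aleph0.trans H.monster'.1) hcard hcard (Ultrafilter.of (atTop : Filter (Finset X)))
    (fun s _ => h' s) (Sum.elim (⇑emb ∘ b) (flat c')) (Sum.elim (⇑emb ∘ b) (f' • flat c'))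
  refine ⟨g PUnit.unit, hP' _ _ h' _ (Eventually.of_forall hh')
    (hg.reindex (Sum.map (fun i => (PUnit.unit, Sum.inl i)) Sum.inl)
      (by rintro α (i | i) <;> rfl) (by rintro (i | i) <;> rfl)), funext fun p => ?_⟩
  refine hg.eq (i := Sum.inl (PUnit.unit, Sum.inr p)) (j := Sum.inr (Sum.inr p)) ?_
  refine Ultrafilter.of_le _ ((eventually_ge_atTop {p.1}).mono fun s hs => ?_)
  exact congrFun (hc' s) (⟨p.1, Finset.singleton_subset_iff.1 hs⟩, p.2)

theorem toGS_mem_agreeSet_iff (H : IsBaseTuple κ κ' emb pE a b) (hV : #V < κ) (hβ : #β < κ)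
    (hInv : SolInv pE a pS bp) (hInv' : SolInv (M := M') pE (⇑emb ∘ a) pS (⇑emb ∘ bp))
    {P : ℕ → Set (Ge pE a)} {P' : ℕ → Set (Ge pE (⇑emb ∘ a))}
    (hPP' : ∀ n h h', IsExt emb h h' → (h ∈ P n ↔ h' ∈ P' n))
    (hP' : ∀ n, IsTypeClosed (⇑emb ∘ b) (P' n))
    (hmul : ∀ n, ∃ m, ∀ h ∈ P' n, ∀ f g₁ g₂ : Ge pE (⇑emb ∘ a),
      g₁ ∈ MulAction.stabilizer (Ge pE (⇑emb ∘ a)) (⇑emb ∘ b) →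
      g₂ ∈ MulAction.stabilizer (Ge pE (⇑emb ∘ a)) (⇑emb ∘ b) → f * g₁ * f⁻¹ * (h * g₂) ∈ P' m)
    {f : Ge pE a} {f' : Ge pE (⇑emb ∘ a)} (hf : IsExt emb f f') :
    toGS pE a hInv f ∈ agreeSet κ hInv (⋃ n, P n) ↔
      toGS pE (⇑emb ∘ a) hInv' f' ∈ agreeSet κ' hInv' (⋃ n, P' n) := by
  constructor
  · intro h
    obtain ⟨n, hn⟩ := exists_uniform_agree (pS := pS) (bp := bp) H.monster.1 (P := P) (f := f)
      (by
        intro X hX c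
        obtain ⟨x, hx, hxc⟩ := h X hX c
        obtain ⟨n, hn⟩ := Set.mem_iUnion.1 hx
        exact ⟨n, x, hn, hxc⟩)
    obtain ⟨m, hm⟩ := hmul n
    intro X hX c'
    obtain ⟨x, hx, hxc⟩ := H.agree'_of_finite hV (hP' m) (f' := f')
      (fun Y hY => H.agree'_of_agree_finite hV hβ (hPP' n) hm hf
        ((lt_aleph0_of_finite Y).trans H.monster.1) (hn Y hY)) hX c'
    exact ⟨x, Set.mem_iUnion.2 ⟨m, hx⟩, hxc⟩
  · intro h X hX c
    obtain ⟨x, hx, hxc⟩ := h X (hX.trans_le H.le) fun i =>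
      ⟨⇑emb ∘ (c i : V → M), comp_mem_solSet_iff.2 (c i).2⟩
    obtain ⟨n, hn⟩ := Set.mem_iUnion.1 hx
    obtain ⟨y, hy, hyc⟩ := H.agree_of_agree' hV (hPP' n) (hP' n) hf hX (flat c) hn hxc
    exact ⟨y, Set.mem_iUnion.2 ⟨n, hy⟩, hyc⟩

end IsBaseTuple
end Relative

section Relation

variable {V β : Type u} {pS : Set (L.Formula (V ⊕ β))} {bp : β → M}
variable {M' : Type u} [L.Structure M'] {emb : M ↪ₑ[L] M'} {κ' : Cardinal.{u}}

namespace IsBaseTuple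

variable {ι : Type u} {b : ι → M}

theorem toGS_mem_agreeSet_preimage_iff (H : IsBaseTuple κ κ' emb pE a b) (hV : #V < κ)
    (hβ : #β < κ) (hInv : SolInv pE a pS bp)
    (hInv' : SolInv (M := M') pE (⇑emb ∘ a) pS (⇑emb ∘ bp)) {P : Set (Ge pE a)}
    {C : Set (GalT κ' pE (⇑emb ∘ a))}
    (hPP' : ∀ h h', IsExt emb h h' → (h ∈ P ↔ h' ∈ projT κ' pE (⇑emb ∘ a) ⁻¹' C))
    (hC : IsTypeClosed (⇑emb ∘ b) (projT κ' pE (⇑emb ∘ a) ⁻¹' C))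
    {f : Ge pE a} {f' : Ge pE (⇑emb ∘ a)} (hf : IsExt emb f f') :
    toGS pE a hInv f ∈ agreeSet κ hInv P ↔ toGS pE (⇑emb ∘ a) hInv' f' ∈
      agreeSet κ' hInv' (projT κ' pE (⇑emb ∘ a) ⁻¹' C) := by
  have := H.toGS_mem_agreeSet_iff hV hβ hInv hInv' (P := fun _ => P)
    (P' := fun _ => projT κ' pE (⇑emb ∘ a) ⁻¹' C) (fun _ => hPP') (fun _ => hC)
    (fun n => ⟨n, ?_⟩) hf
  · simpa only [Set.iUnion_const] using this
  intro h hh k g₁ g₂ hg₁ hg₂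
  have h1 := (AutfL_normal κ' pE (⇑emb ∘ a)).conj_mem _ (H.stabilizer_le' hg₁) k
  have h2 := (AutfL_normal κ' pE (⇑emb ∘ a)).conj_mem _ h1 h⁻¹
  have h3 := mul_mem_preimage_projT hh (mul_mem h2 (H.stabilizer_le' hg₂))
  convert h3 using 1
  group

theorem toGS_mem_AutfLS_iff (H : IsBaseTuple κ κ' emb pE a b) (hV : #V < κ) (hβ : #β < κ)
    (hInv : SolInv pE a pS bp) (hInv' : SolInv (M := M') pE (⇑emb ∘ a) pS (⇑emb ∘ bp))
    {f : Ge pE a} {f' : Ge pE (⇑emb ∘ a)} (hf : IsExt emb f f') :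
    toGS pE a hInv f ∈ AutfLS κ pE a hInv ↔
      toGS pE (⇑emb ∘ a) hInv' f' ∈ AutfLS κ' pE (⇑emb ∘ a) hInv' := by
  have hclosed := isTypeClosed_lascarBall H.monster' H.equivalence' H.mk_rep_lt' H.mk_index_lt'
    H.dcl'
  have h1 : (⋃ n, lascarBall b n) = (AutfL κ pE a : Set (Ge pE a)) :=
    Set.ext fun h => Set.mem_iUnion.trans
      (mem_AutfL_iff_lascarBall H.monster H.mk_index_lt H.dcl H.stabilizer_le).symm
  have h2 : (⋃ n, lascarBall (⇑emb ∘ b) n) =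
      (AutfL κ' pE (⇑emb ∘ a) : Set (Ge pE (⇑emb ∘ a))) :=
    Set.ext fun h => Set.mem_iUnion.trans
      (mem_AutfL_iff_lascarBall H.monster' H.mk_index_lt' H.dcl' H.stabilizer_le').symm
  have := H.toGS_mem_agreeSet_iff hV hβ hInv hInv' (P := lascarBall b)
    (P' := lascarBall (⇑emb ∘ b)) (fun n h h' hext => H.mem_lascarBall_iff hext) hclosed
    (fun n => ⟨n + 1, ?_⟩) hf
  · rw [h1, h2] at this
    exact this
  intro h hh k g₁ g₂ hg₁ hg₂
  refine mul_mem_lascarBall (u := k) ?_ ((hclosed n).mem_of_sameTp hh ?_)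
  · rw [mul_smul, mul_smul, inv_smul_smul, MulAction.mem_stabilizer_iff.1 hg₁]
  · rw [mul_smul, MulAction.mem_stabilizer_iff.1 hg₂]
    exact SameTp.refl _

theorem exists_relation (H : IsBaseTuple κ κ' emb pE a b) (hInv : SolInv pE a pS bp)
    (hInv' : SolInv (M := M') pE (⇑emb ∘ a) pS (⇑emb ∘ bp)) {X : Set (GS pE a hInv)}
    {X' : Set (GS (M := M') pE (⇑emb ∘ a) hInv')}
    (hX' : ∀ σ ∈ X', ∀ l ∈ AutfLS κ' pE (⇑emb ∘ a) hInv', σ * l ∈ X')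
    (hXX' : ∀ f f', IsExt emb f f' →
      (toGS pE a hInv f ∈ X ↔ toGS pE (⇑emb ∘ a) hInv' f' ∈ X')) :
    ∃ R : GS pE a hInv → GS (M := M') pE (⇑emb ∘ a) hInv' → Prop,
      (∀ σ, ∃ σ', R σ σ') ∧ (∀ σ', ∃ σ, R σ σ') ∧
      (∀ σ τ σ' τ', R σ σ' → R τ τ' → R (σ * τ) (σ' * τ')) ∧
      (∀ σ τ σ' τ', R σ σ' → R τ τ' → (σ⁻¹ * τ ∈ X ↔ σ'⁻¹ * τ' ∈ X')) ∧
      (∀ (f : Ge pE a) (f' : Ge (M := M') pE (⇑emb ∘ a)),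
        (∀ x : M, (f' : M' ≃[L] M') (emb x) = emb ((f : M ≃[L] M) x)) →
        R (toGS pE a hInv f) (toGS pE (⇑emb ∘ a) hInv' f')) := by
  have hnorm := AutfLS_normal κ' pE (⇑emb ∘ a) hInv'
  have hsurj : ∀ σ, ∃ f, toGS pE a hInv f = σ := MonoidHom.rangeRestrict_surjective _
  have hsurj' : ∀ σ, ∃ f, toGS pE (⇑emb ∘ a) hInv' f = σ := MonoidHom.rangeRestrict_surjective _
  refine ⟨fun σ σ' => ∃ (f : Ge pE a) (f' : Ge pE (⇑emb ∘ a)), IsExt emb f f' ∧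
    σ = toGS pE a hInv f ∧ ∃ l ∈ AutfLS κ' pE (⇑emb ∘ a) hInv',
      σ' = toGS pE (⇑emb ∘ a) hInv' f' * l, ?_, ?_, ?_, ?_, ?_⟩
  · intro σ
    obtain ⟨f, rfl⟩ := hsurj σ
    obtain ⟨f', hf⟩ := H.exists_ext f
    exact ⟨_, f, f', hf, rfl, 1, one_mem _, rfl⟩
  · intro σ'
    obtain ⟨g', rfl⟩ := hsurj' σ'
    obtain ⟨f, f', hf, hg⟩ := H.exists_isExt_sameTp g'
    refine ⟨_, f, f', hf, rfl, toGS pE (⇑emb ∘ a) hInv' (f'⁻¹ * g'),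
      toGS_mem_autfLS _ _ _ _ (projT_eq_iff.1 (H.projT_eq' hg)), ?_⟩
    rw [← map_mul, mul_inv_cancel_left]
  · rintro _ _ _ _ ⟨f, f', hf, rfl, l, hl, rfl⟩ ⟨g, g', hg, rfl, k, hk, rfl⟩
    refine ⟨f * g, f' * g', hf.mul hg, (map_mul _ _ _).symm, _,
      mul_mem (hnorm.conj_mem l hl (toGS pE (⇑emb ∘ a) hInv' g')⁻¹) hk, ?_⟩
    rw [map_mul]
    group
  · rintro _ _ _ _ ⟨f, f', hf, rfl, l, hl, rfl⟩ ⟨g, g', hg, rfl, k, hk, rfl⟩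
    rw [← map_inv, ← map_mul, hXX' _ _ (hf.inv.mul hg)]
    have hm := mul_mem (hnorm.conj_mem l⁻¹ (inv_mem hl)
      (toGS pE (⇑emb ∘ a) hInv' (f'⁻¹ * g'))⁻¹) hk
    have heq : (toGS pE (⇑emb ∘ a) hInv' f' * l)⁻¹ * (toGS pE (⇑emb ∘ a) hInv' g' * k) =
        toGS pE (⇑emb ∘ a) hInv' (f'⁻¹ * g') * ((toGS pE (⇑emb ∘ a) hInv' (f'⁻¹ * g'))⁻¹ * l⁻¹ *
          (toGS pE (⇑emb ∘ a) hInv' (f'⁻¹ * g'))⁻¹⁻¹ * k) := by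
      rw [map_mul, map_inv]
      group
    rw [heq]
    refine ⟨fun h => hX' _ h _ hm, fun h => ?_⟩
    have := hX' _ h _ (inv_mem hm)
    rwa [mul_inv_cancel_right] at this
  · exact fun f f' hf => ⟨f, f', hf, rfl, 1, one_mem _, (mul_one _).symm⟩

end IsBaseTuple
end Relation

end Hyperimaginary

end MonsterChange

section Statements

variable {γ : Type u} (pE : Set (L.Formula (γ ⊕ γ))) (a : γ → M)
variable {V β : Type u} {pS : Set (L.Formula (V ⊕ β))} {bp : β → M}


/-- Fact 1.19: the relativized Lascar, KP, and Shelah groups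
do not depend on the choice of the monster model: for monster models `𝔠 ≺ 𝔠'`,
the map sending the coset of `f ↾ Σ(𝔠)` to the coset of `f' ↾ Σ(𝔠')`, where
`f'` is any extension of `f`, is a well-defined group isomorphism
`Gal_X(Σ(𝔠), e) ≅ Gal_X(Σ(𝔠'), e)`, for each `X ∈ {L, KP, S}`.  (The
isomorphism of quotient groups is expressed by a relation `R` on representatives
that is total, surjective, multiplicative, and induces a well-defined bijection
on the cosets of `Autf_X(Σ, e)`, extending the map `f ↾ Σ(𝔠) ↦ f' ↾ Σ(𝔠')`.) -/
theorem galXS_independent_of_monster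
    {M' : Type u} [L.Structure M'] (emb : M ↪ₑ[L] M') {κ' : Cardinal.{u}}
    (hM : IsMonster κ L M) (hM' : IsMonster κ' L M') (hκ : κ ≤ κ') (hMs : #M < κ')
    (hγ : #γ < κ) (hE : Equivalence (Frel (M := M) pE))
    (hE' : Equivalence (Frel (M := M') pE)) (hV : #V < κ) (hβ : #β < κ)
    (hInv : SolInv pE a pS bp)
    (hInv' : SolInv (M := M') pE (⇑emb ∘ a) pS (⇑emb ∘ bp))
    (N : L.ElementarySubstructure M) (hN : #N < κ)
    (hNdcl : ∀ g : M ≃[L] M, (∀ x ∈ N, g x = x) → g ∈ AutE pE a)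
    (N' : L.ElementarySubstructure M') (hN' : #N' < κ')
    (hN'dcl : ∀ g : M' ≃[L] M', (∀ x ∈ N', g x = x) → g ∈ AutE pE (⇑emb ∘ a)) :
    (∃ R : GS pE a hInv → GS (M := M') pE (⇑emb ∘ a) hInv' → Prop,
      (∀ σ, ∃ σ', R σ σ') ∧ (∀ σ', ∃ σ, R σ σ') ∧
      (∀ σ τ σ' τ', R σ σ' → R τ τ' → R (σ * τ) (σ' * τ')) ∧
      (∀ σ τ σ' τ', R σ σ' → R τ τ' →
        ((σ⁻¹ * τ) ∈ (AutfLS κ pE a hInv : Set (GS pE a hInv)) ↔ (σ'⁻¹ * τ') ∈ (AutfLS κ' pE (⇑emb ∘ a) hInv' : Set (GS (M := M') pE (⇑emb ∘ a) hInv')))) ∧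
      (∀ (f : Ge pE a) (f' : Ge (M := M') pE (⇑emb ∘ a)),
        (∀ x : M, (f' : M' ≃[L] M') (emb x) = emb ((f : M ≃[L] M) x)) →
        R (toGS pE a hInv f) (toGS pE (⇑emb ∘ a) hInv' f'))) ∧
    (∃ R : GS pE a hInv → GS (M := M') pE (⇑emb ∘ a) hInv' → Prop,
      (∀ σ, ∃ σ', R σ σ') ∧ (∀ σ', ∃ σ, R σ σ') ∧
      (∀ σ τ σ' τ', R σ σ' → R τ τ' → R (σ * τ) (σ' * τ')) ∧
      (∀ σ τ σ' τ', R σ σ' → R τ τ' →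
        ((σ⁻¹ * τ) ∈ AutfKPSset κ pE a hInv N ↔ (σ'⁻¹ * τ') ∈ AutfKPSset κ' pE (⇑emb ∘ a) hInv' N')) ∧
      (∀ (f : Ge pE a) (f' : Ge (M := M') pE (⇑emb ∘ a)),
        (∀ x : M, (f' : M' ≃[L] M') (emb x) = emb ((f : M ≃[L] M) x)) →
        R (toGS pE a hInv f) (toGS pE (⇑emb ∘ a) hInv' f'))) ∧
    (∃ R : GS pE a hInv → GS (M := M') pE (⇑emb ∘ a) hInv' → Prop,
      (∀ σ, ∃ σ', R σ σ') ∧ (∀ σ', ∃ σ, R σ σ') ∧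
      (∀ σ τ σ' τ', R σ σ' → R τ τ' → R (σ * τ) (σ' * τ')) ∧
      (∀ σ τ σ' τ', R σ σ' → R τ τ' →
        ((σ⁻¹ * τ) ∈ AutfSSset κ pE a hInv N ↔ (σ'⁻¹ * τ') ∈ AutfSSset κ' pE (⇑emb ∘ a) hInv' N')) ∧
      (∀ (f : Ge pE a) (f' : Ge (M := M') pE (⇑emb ∘ a)),
        (∀ x : M, (f' : M' ≃[L] M') (emb x) = emb ((f : M ≃[L] M) x)) →
        R (toGS pE a hInv f) (toGS pE (⇑emb ∘ a) hInv' f'))) := by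
  have hNdcl' : eInDclTuple pE a ((↑) : N → M) := fun g hg => hNdcl g fun x hx => hg ⟨x, hx⟩
  have hN'dcl' : eInDclTuple pE (⇑emb ∘ a) ((↑) : N' → M') :=
    fun g hg => hN'dcl g fun x hx => hg ⟨x, hx⟩
  have H : IsBaseTuple κ κ' emb pE a ((↑) : N → M) :=
    isBaseTuple_coe hM hM' hκ hMs hγ hE hE' N hN hNdcl'
  refine ⟨H.exists_relation hInv hInv' (fun σ hσ l hl => mul_mem hσ hl) fun f f' hf =>
      H.toGS_mem_AutfLS_iff hV hβ hInv hInv' hf,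
    H.exists_relation hInv hInv' (fun σ hσ l hl => ?_) fun f f' hf => ?_,
    H.exists_relation hInv hInv' (fun σ hσ l hl => ?_) fun f f' hf => ?_⟩
  · exact mul_mem_agreeSet (fun h hh x hx => mul_mem_preimage_projT hh hx) hσ hl
  · exact H.toGS_mem_agreeSet_preimage_iff hV hβ hInv hInv'
      (fun h h' hext => H.mem_AutfKPset_iff hN' hN'dcl' hext)
      (H.isTypeClosed_AutfKPset hN' hN'dcl') hf
  · exact mul_mem_agreeSet (fun h hh x hx => mul_mem_preimage_projT hh hx) hσ hl
  · exact H.toGS_mem_agreeSet_preimage_iff hV hβ hInv hInv'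
      (fun h h' hext => H.mem_AutfSset_iff hN' hN'dcl' hext)
      (H.isTypeClosed_AutfSset hN' hN'dcl') hf

end Statements

end RelLascar
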